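/- For every κ > 9/2 and every s ∈ ℕ there exists C > 0 such that for all φ, ψ ∈ C^∞(ℝ²) for which the right-hand side below is finite: ‖e^{−κ⟨z⟩} φ ψ‖_{(s)} ≤ C ( ‖e^{−2|z|} φ‖_{L^∞(ℝ²)} ‖ψ‖_{(s)} + ‖φ‖_{(s)} ‖e^{−2|z|} ψ‖_{L^∞(ℝ²)} ). -/

import Mathlib

open Real MeasureTheory Filter Set
open scoped ENNReal NNReal
noncomputable section

/-- Euclidean norm of a point of `ℝ²`. -/
def znorm (z : Fin 2 → ℝ) : ℝ := Real.sqrt (z 0 ^ 2 + z 1 ^ 2)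

/-- The Japanese bracket `⟨z⟩ = √(1 + |z|²)`. -/
def zjap (z : Fin 2 → ℝ) : ℝ := Real.sqrt (1 + (z 0 ^ 2 + z 1 ^ 2))

/-- `sinh r / r`, extended by `1` at `r = 0`. -/
def sinhc (r : ℝ) : ℝ := if r = 0 then 1 else Real.sinh r / r

/-- `G(z) = (sinh |z| / |z|)²`, extended by `G(0) = 1`. -/
def Gfun (z : Fin 2 → ℝ) : ℝ := sinhc (znorm z) ^ 2

/-- The matrix `M(z) = [[z₂², −z₁z₂],[−z₁z₂, z₁²]]` (indices `0,1`). -/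
def Mmat (z : Fin 2 → ℝ) (j k : Fin 2) : ℝ :=
  if j = 0 then (if k = 0 then z 1 ^ 2 else -(z 0 * z 1))
  else (if k = 0 then -(z 0 * z 1) else z 0 ^ 2)

/-- `g^{jk}(z) = δ_{jk} − (1/|z|² − 1/sinh²|z|) M_{jk}(z)`, extended by `g(0) = Id`. -/
def gmat (z : Fin 2 → ℝ) (j k : Fin 2) : ℝ :=
  if znorm z = 0 then (if j = k then 1 else 0)
  else (if j = k then 1 else 0)
    - (1 / znorm z ^ 2 - 1 / Real.sinh (znorm z) ^ 2) * Mmat z j k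

/-- Partial derivative `∂_{z_k}` of a function on `ℝ²`. -/
def pd (k : Fin 2) (f : (Fin 2 → ℝ) → ℝ) (z : Fin 2 → ℝ) : ℝ :=
  fderiv ℝ f z (Pi.single k 1)

/-- `Λ₀ v = G(z)^{−1/2} Σ_{i,j} ∂_{z_i}(G(z)^{1/2} g^{ij}(z) ∂_{z_j} v)`. -/
def Lam0 (v : (Fin 2 → ℝ) → ℝ) (z : Fin 2 → ℝ) : ℝ :=
  (Real.sqrt (Gfun z))⁻¹ *
    ∑ i, pd i (fun w => Real.sqrt (Gfun w) * ∑ j, gmat w i j * pd j v w) z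

/-- `Λ v = e^{κ⟨z⟩} Λ₀ (e^{−κ⟨z⟩} v)`. -/
def Lam (κ : ℝ) (v : (Fin 2 → ℝ) → ℝ) (z : Fin 2 → ℝ) : ℝ :=
  Real.exp (κ * zjap z) * Lam0 (fun w => Real.exp (-(κ * zjap w)) * v w) z

/-- `P_m v = ∂_τ² v − τ⁻² Λ v + m² v`. -/
def Pm (m κ : ℝ) (v : ℝ → (Fin 2 → ℝ) → ℝ) (τ : ℝ) (z : Fin 2 → ℝ) : ℝ :=
  iteratedDeriv 2 (fun s => v s z) τ - (1 / τ ^ 2) * Lam κ (v τ) z + m ^ 2 * v τ z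

/-- Coefficient matrix `c(z) = zzᵀ/|z|² + (|z|/tanh|z|)(Id − zzᵀ/|z|²)`, `c(0) = Id`. -/
def cmat (z : Fin 2 → ℝ) (j k : Fin 2) : ℝ :=
  if znorm z = 0 then (if j = k then 1 else 0)
  else z j * z k / znorm z ^ 2
    + (znorm z / Real.tanh (znorm z)) * ((if j = k then 1 else 0) - z j * z k / znorm z ^ 2)

/-- The vector fields `Γ₁, Γ₂, Γ₃` (indices `0,1,2`). -/
def GammaOp (j : Fin 3) (φ : (Fin 2 → ℝ) → ℝ) (z : Fin 2 → ℝ) : ℝ :=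
  if j = 0 then ∑ k, cmat z 0 k * pd k φ z
  else if j = 1 then ∑ k, cmat z 1 k * pd k φ z
  else z 0 * pd 1 φ z - z 1 * pd 0 φ z

/-- `Γ^I = Γ₁^{I₁} Γ₂^{I₂} Γ₃^{I₃}` for a multi-index `I`. -/
def GammaI (I : ℕ × ℕ × ℕ) (φ : (Fin 2 → ℝ) → ℝ) : (Fin 2 → ℝ) → ℝ :=
  (GammaOp 0)^[I.1] ((GammaOp 1)^[I.2.1] ((GammaOp 2)^[I.2.2] φ))

/-- The multi-indices `I ∈ ℕ³` with `|I| ≤ s`. -/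
def multiIndices (s : ℕ) : Finset (ℕ × ℕ × ℕ) :=
  (Finset.range (s+1) ×ˢ Finset.range (s+1) ×ˢ Finset.range (s+1)).filter
    (fun I => I.1 + I.2.1 + I.2.2 ≤ s)

/-- `‖φ‖_{(s)} = Σ_{|I|≤s} ‖Γ^I φ‖_{L²(ℝ², √G(z) dz)}`. -/
def sNorm (s : ℕ) (φ : (Fin 2 → ℝ) → ℝ) : ℝ :=
  ∑ I ∈ multiIndices s,
    Real.sqrt (∫ z : Fin 2 → ℝ, (GammaI I φ z) ^ 2 * Real.sqrt (Gfun z))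

/-- The energy `E_s(τ; v, m)`. -/
def energy (s : ℕ) (m : ℝ) (v : ℝ → (Fin 2 → ℝ) → ℝ) (τ : ℝ) : ℝ :=
  ∑ I ∈ multiIndices s, (1/2) * ∫ z : Fin 2 → ℝ,
    ((deriv (fun σ => GammaI I (v σ) z) τ) ^ 2
      + (1 / τ ^ 2) * ∑ j, ∑ k,
          gmat z j k * pd j (GammaI I (v τ)) z * pd k (GammaI I (v τ)) z
      + m ^ 2 * (GammaI I (v τ) z) ^ 2) * Real.sqrt (Gfun z)
noncomputable section

/-- The measure `√G(z) dz` on `ℝ²`. -/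
def Gmeasure : Measure (Fin 2 → ℝ) :=
  volume.withDensity (fun z => ENNReal.ofReal (Real.sqrt (Gfun z)))

/-- `‖φ‖_{(s)} = Σ_{|I|≤s} ‖Γ^I φ‖_{L²(ℝ², √G(z) dz)}`, valued in `ℝ≥0∞`. -/
def sNormE (s : ℕ) (φ : (Fin 2 → ℝ) → ℝ) : ℝ≥0∞ :=
  ∑ I ∈ multiIndices s, eLpNorm (GammaI I φ) 2 Gmeasure

/-- The entire function `t ↦ ∑ tⁿ / (2n+1)!`, which satisfies `sinhc r = sinhcSq (r ^ 2)`. -/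
def sinhcSq (t : ℝ) : ℝ := ∑' n : ℕ, ((Nat.factorial (2 * n + 1) : ℝ))⁻¹ * t ^ n

lemma contDiff_sinhcSq : ContDiff ℝ (⊤ : ℕ∞) sinhcSq := by
  set c : ℕ → ℝ := fun n => ((Nat.factorial (2 * n + 1) : ℝ))⁻¹ with hc
  have hrad : (FormalMultilinearSeries.ofScalars ℝ c).radius = ⊤ := by
    apply FormalMultilinearSeries.ofScalars_radius_eq_top_of_tendsto
    · exact Eventually.of_forall fun n => by positivity
    · have h : ∀ n, ‖c n.succ‖ / ‖c n‖ = ((2 * n + 3 : ℝ) * (2 * n + 2))⁻¹ := by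
        intro n
        have h1 : Nat.factorial (2 * n.succ + 1) =
            (2 * n + 3) * ((2 * n + 2) * Nat.factorial (2 * n + 1)) := by
          rw [show 2 * n.succ + 1 = (2 * n + 1) + 1 + 1 by rw [Nat.succ_eq_add_one]; ring,
            Nat.factorial_succ, Nat.factorial_succ]
        simp only [hc, h1]
        have : (0 : ℝ) < Nat.factorial (2 * n + 1) := by positivity
        rw [Real.norm_of_nonneg (by positivity), Real.norm_of_nonneg (by positivity)]
        push_cast
        field_simp
      simp_rw [h]
      refine squeeze_zero (fun n => by positivity) (fun n => ?_)
        tendsto_one_div_add_atTop_nhds_zero_nat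
      rw [one_div]
      gcongr
      nlinarith [(Nat.cast_nonneg n : (0 : ℝ) ≤ n)]
  have hfun : sinhcSq = (FormalMultilinearSeries.ofScalars ℝ c).sum := by
    funext t
    have := FormalMultilinearSeries.ofScalarsSum_eq_tsum (E := ℝ) c
    rw [FormalMultilinearSeries.ofScalarsSum] at this
    rw [this]
    simp [sinhcSq, hc, smul_eq_mul]
  have hps := (FormalMultilinearSeries.ofScalars ℝ c).hasFPowerSeriesOnBall (by rw [hrad]; simp)
  rw [contDiff_iff_contDiffAt]
  intro t
  rw [hfun]
  refine (hps.analyticAt_of_mem ?_).contDiffAt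
  rw [hrad]; simp

lemma mul_sinhcSq (r : ℝ) : r * sinhcSq (r ^ 2) = Real.sinh r := by
  rw [Real.sinh_eq_tsum, sinhcSq, ← tsum_mul_left]
  congr 1; funext n
  rw [div_eq_inv_mul]; ring

lemma sinhcSq_pos {t : ℝ} (ht : 0 ≤ t) : 0 < sinhcSq t := by
  rcases ht.eq_or_lt with rfl | ht
  · rw [sinhcSq, tsum_eq_single 0 (by intro n hn; simp [hn])]; simp
  · have h := mul_sinhcSq (√t)
    rw [Real.sq_sqrt ht.le] at h
    have h2 : 0 < Real.sinh √t := Real.sinh_pos_iff.2 (Real.sqrt_pos.2 ht)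
    exact pos_of_mul_pos_right (h ▸ h2) (Real.sqrt_nonneg t)

lemma hasDerivAt_sinhcSq (t : ℝ) : HasDerivAt sinhcSq (deriv sinhcSq t) t :=
  (contDiff_sinhcSq.differentiable (by simp) t).hasDerivAt

lemma contDiff_deriv_sinhcSq : ContDiff ℝ (⊤ : ℕ∞) (deriv sinhcSq) :=
  (contDiff_infty_iff_deriv.1 contDiff_sinhcSq).2

lemma hasDerivAt_deriv_sinhcSq (t : ℝ) :
    HasDerivAt (deriv sinhcSq) (deriv (deriv sinhcSq) t) t :=
  (contDiff_deriv_sinhcSq.differentiable (by simp) t).hasDerivAt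

lemma sinhcSq_add_deriv (r : ℝ) :
    sinhcSq (r ^ 2) + 2 * r ^ 2 * deriv sinhcSq (r ^ 2) = Real.cosh r := by
  have hsq : HasDerivAt (fun r : ℝ => r ^ 2) (2 * r) r := by simpa using hasDerivAt_pow 2 r
  have h1 := (hasDerivAt_id r).mul ((hasDerivAt_sinhcSq (r ^ 2)).comp r hsq)
  have h2 : (id * (sinhcSq ∘ fun r : ℝ => r ^ 2)) = Real.sinh := by
    funext x; exact mul_sinhcSq x
  rw [h2] at h1
  have := h1.unique (Real.hasDerivAt_sinh r)
  rw [← this]; simp; ring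

lemma sinhcSq_ode {t : ℝ} (ht : 0 ≤ t) :
    4 * t * deriv (deriv sinhcSq) t + 6 * deriv sinhcSq t = sinhcSq t := by
  have key : EqOn (fun t => 4 * t * deriv (deriv sinhcSq) t + 6 * deriv sinhcSq t) sinhcSq
      (Ioi 0) := by
    intro t ht
    have ht : 0 < t := ht
    set r := √t with hr
    have hr0 : 0 < r := Real.sqrt_pos.2 ht
    have hrt : t = r ^ 2 := (Real.sq_sqrt ht.le).symm
    have hsq : HasDerivAt (fun r : ℝ => r ^ 2) (2 * r) r := by simpa using hasDerivAt_pow 2 r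
    have h1 := ((hasDerivAt_sinhcSq (r ^ 2)).comp r hsq).add
      ((hsq.const_mul 2).mul ((hasDerivAt_deriv_sinhcSq (r ^ 2)).comp r hsq))
    have h2 : ((sinhcSq ∘ fun r : ℝ => r ^ 2) +
        (fun r : ℝ => 2 * r ^ 2) * (deriv sinhcSq ∘ fun r : ℝ => r ^ 2)) = Real.cosh := by
      funext x; exact sinhcSq_add_deriv x
    rw [h2] at h1
    have h3 := h1.unique (Real.hasDerivAt_cosh r)
    rw [← mul_sinhcSq r] at h3
    simp only [Function.comp] at h3
    rw [hrt]
    refine mul_left_cancel₀ hr0.ne' ?_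
    simp only
    linarith
  have hd2 : Continuous (deriv (deriv sinhcSq)) :=
    (contDiff_infty_iff_deriv.1 contDiff_deriv_sinhcSq).2.continuous
  have hcl := key.closure (by have := contDiff_deriv_sinhcSq.continuous; fun_prop)
    contDiff_sinhcSq.continuous
  rw [closure_Ioi] at hcl
  exact hcl ht

/-- The coefficient function `h` for which `c(z) = (1 - |z|² h(|z|²)) Id + h(|z|²) zzᵀ`. -/
def twistCoeff (t : ℝ) : ℝ := -2 * deriv sinhcSq t / sinhcSq t

/-- The squared Euclidean norm of a point of the plane. -/
def normSqFun (z : Fin 2 → ℝ) : ℝ := z 0 ^ 2 + z 1 ^ 2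

lemma normSqFun_nonneg (z : Fin 2 → ℝ) : 0 ≤ normSqFun z := by
  unfold normSqFun; positivity

lemma znorm_sq (z : Fin 2 → ℝ) : znorm z ^ 2 = normSqFun z :=
  Real.sq_sqrt (normSqFun_nonneg z)

lemma contDiff_normSqFun : ContDiff ℝ (⊤ : ℕ∞) normSqFun := by
  unfold normSqFun; fun_prop

lemma sinhc_eq (r : ℝ) : sinhc r = sinhcSq (r ^ 2) := by
  unfold sinhc
  split_ifs with h
  · have := sinhcSq_add_deriv 0
    simp at this
    simp [h, this]
  · rw [← mul_sinhcSq r]; field_simp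

lemma sqrt_Gfun (z : Fin 2 → ℝ) : √(Gfun z) = sinhcSq (normSqFun z) := by
  rw [Gfun, sinhc_eq, znorm_sq, Real.sqrt_sq (sinhcSq_pos (normSqFun_nonneg z)).le]

lemma contDiff_twistCoeff_comp :
    ContDiff ℝ (⊤ : ℕ∞) (fun z : Fin 2 → ℝ => twistCoeff (normSqFun z)) := by
  unfold twistCoeff
  refine ContDiff.div ?_ (contDiff_sinhcSq.comp contDiff_normSqFun)
    fun z => (sinhcSq_pos (normSqFun_nonneg z)).ne'
  exact contDiff_const.mul (contDiff_deriv_sinhcSq.comp contDiff_normSqFun)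

lemma hasDerivAt_twistCoeff {t : ℝ} (ht : 0 ≤ t) :
    HasDerivAt twistCoeff (deriv twistCoeff t) t := by
  apply DifferentiableAt.hasDerivAt
  unfold twistCoeff
  exact ((hasDerivAt_deriv_sinhcSq t).differentiableAt.const_mul _).div
    (hasDerivAt_sinhcSq t).differentiableAt (sinhcSq_pos ht).ne'

lemma twistCoeff_ode {t : ℝ} (ht : 0 ≤ t) :
    2 * t * deriv twistCoeff t = -1 - 3 * twistCoeff t + t * twistCoeff t ^ 2 := by
  have hS := (sinhcSq_pos ht).ne'
  have h : HasDerivAt twistCoeff _ t :=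
    (((hasDerivAt_deriv_sinhcSq t).const_mul (-2)).div (hasDerivAt_sinhcSq t) hS)
  rw [h.deriv, twistCoeff]
  have ode := sinhcSq_ode ht
  field_simp
  have : t * 4 * deriv (deriv sinhcSq) t = sinhcSq t - 6 * deriv sinhcSq t := by linarith
  linear_combination (-sinhcSq t) * this

lemma cmat_eq (z : Fin 2 → ℝ) (j k : Fin 2) :
    cmat z j k = (if j = k then 1 - normSqFun z * twistCoeff (normSqFun z) else 0)
      + twistCoeff (normSqFun z) * (z j * z k) := by
  unfold cmat
  split_ifs with h h1 h1
  · have h0 : normSqFun z = 0 := by rw [← znorm_sq, h]; simp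
    have : z 0 = 0 ∧ z 1 = 0 := by
      unfold normSqFun at h0
      constructor <;> nlinarith [sq_nonneg (z 0), sq_nonneg (z 1)]
    have hj : z j = 0 := by fin_cases j <;> simp [this]
    simp [h0, hj]
  · have h0 : normSqFun z = 0 := by rw [← znorm_sq, h]; simp
    have : z 0 = 0 ∧ z 1 = 0 := by
      unfold normSqFun at h0
      constructor <;> nlinarith [sq_nonneg (z 0), sq_nonneg (z 1)]
    have hj : z j = 0 := by fin_cases j <;> simp [this]
    simp [hj]
  all_goals
    have hr : 0 < znorm z := lt_of_le_of_ne (Real.sqrt_nonneg _) (Ne.symm h)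
    have hs : 0 < sinhcSq (znorm z ^ 2) := sinhcSq_pos (sq_nonneg _)
    rw [← znorm_sq, Real.tanh_eq_sinh_div_cosh, ← mul_sinhcSq, ← sinhcSq_add_deriv, twistCoeff]
    field_simp
    ring

/-- The algebra of smooth functions on the plane. -/
def smoothFun : Subalgebra ℝ ((Fin 2 → ℝ) → ℝ) where
  carrier := {F | ContDiff ℝ (⊤ : ℕ∞) F}
  mul_mem' := @fun F G (hF : ContDiff ℝ (⊤ : ℕ∞) F) (hG : ContDiff ℝ (⊤ : ℕ∞) G) =>
    show ContDiff ℝ (⊤ : ℕ∞) (F * G) from hF.mul hG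
  add_mem' := @fun F G (hF : ContDiff ℝ (⊤ : ℕ∞) F) (hG : ContDiff ℝ (⊤ : ℕ∞) G) =>
    show ContDiff ℝ (⊤ : ℕ∞) (F + G) from hF.add hG
  algebraMap_mem' := fun c => show ContDiff ℝ (⊤ : ℕ∞) (fun _ : Fin 2 → ℝ => c) from contDiff_const

lemma smoothFun.contDiff (F : smoothFun) : ContDiff ℝ (⊤ : ℕ∞) (F : (Fin 2 → ℝ) → ℝ) := F.2

lemma smoothFun.differentiable (F : smoothFun) : Differentiable ℝ (F : (Fin 2 → ℝ) → ℝ) :=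
  (smoothFun.contDiff F).differentiable (by simp)

lemma contDiff_pd (k : Fin 2) {F : (Fin 2 → ℝ) → ℝ} (hF : ContDiff ℝ (⊤ : ℕ∞) F) :
    ContDiff ℝ (⊤ : ℕ∞) (pd k F) := by
  unfold pd
  exact (hF.fderiv_right (m := (⊤ : ℕ∞)) (by simp)).clm_apply contDiff_const

/-- The partial derivative as a derivation of the algebra of smooth functions. -/
def pdDer (k : Fin 2) : Derivation ℝ smoothFun smoothFun :=
  Derivation.mk'
    { toFun := fun F => ⟨pd k F, contDiff_pd k (smoothFun.contDiff F)⟩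
      map_add' := fun F G => by
        ext z
        simp [pd, fderiv_add (smoothFun.differentiable F z) (smoothFun.differentiable G z)]
      map_smul' := fun c F => by
        ext z
        simp [pd, fderiv_const_smul (smoothFun.differentiable F z)] }
    (fun F G => by
      ext z
      simp [pd, fderiv_mul (smoothFun.differentiable F z) (smoothFun.differentiable G z)])

lemma pdDer_apply (k : Fin 2) (F : smoothFun) : (pdDer k F : (Fin 2 → ℝ) → ℝ) = pd k F := rfl

lemma pdDer_comm (F : smoothFun) : pdDer 0 (pdDer 1 F) = pdDer 1 (pdDer 0 F) := by
  ext z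
  have hF : ContDiff ℝ (⊤ : ℕ∞) (F : (Fin 2 → ℝ) → ℝ) := F.2
  have hsymm : IsSymmSndFDerivAt ℝ (F : (Fin 2 → ℝ) → ℝ) z :=
    hF.contDiffAt.isSymmSndFDerivAt (by simp; exact WithTop.coe_le_coe.2 (le_top : (2 : ℕ∞) ≤ ⊤))
  have hd : DifferentiableAt ℝ (fderiv ℝ (F : (Fin 2 → ℝ) → ℝ)) z :=
    ((hF.fderiv_right (m := (⊤ : ℕ∞)) (by simp)).differentiable (by simp)) z
  simp only [pdDer_apply]
  unfold pd
  rw [fderiv_clm_apply hd (differentiableAt_const _), fderiv_clm_apply hd (differentiableAt_const _)]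
  simpa using hsymm.eq _ _

/-- A coordinate function as a smooth function. -/
def coordFun (k : Fin 2) : smoothFun :=
  ⟨fun z => z k, show ContDiff ℝ (⊤ : ℕ∞) (fun z : Fin 2 → ℝ => z k) from contDiff_apply ℝ ℝ k⟩

/-- The coefficient `h(|z|²)` as a smooth function. -/
def twistFun : smoothFun := ⟨fun z => twistCoeff (normSqFun z), contDiff_twistCoeff_comp⟩

/-- The rotation field `Γ₃` as a derivation. -/
def rotDer : Derivation ℝ smoothFun smoothFun := coordFun 0 • pdDer 1 - coordFun 1 • pdDer 0

/-- The fields `Γ₁, Γ₂, Γ₃` as derivations of the algebra of smooth functions. -/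
def gammaDer (i : Fin 3) : Derivation ℝ smoothFun smoothFun :=
  ![pdDer 0 + (twistFun * coordFun 1) • rotDer, pdDer 1 - (twistFun * coordFun 0) • rotDer,
    rotDer] i

lemma gammaDer_apply (i : Fin 3) (F : smoothFun) :
    (gammaDer i F : (Fin 2 → ℝ) → ℝ) = GammaOp i F := by
  funext z
  fin_cases i
  · simp [gammaDer, GammaOp, rotDer, pdDer_apply, cmat_eq, twistFun, coordFun, normSqFun]
    ring
  · simp [gammaDer, GammaOp, rotDer, pdDer_apply, cmat_eq, twistFun, coordFun, normSqFun]
    ring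
  · simp [gammaDer, GammaOp, rotDer, pdDer_apply, coordFun]

lemma pdDer_coordFun (j k : Fin 2) : pdDer j (coordFun k) = if j = k then 1 else 0 := by
  ext z
  have : fderiv ℝ (fun w : Fin 2 → ℝ => w k) z = ContinuousLinearMap.proj k :=
    (ContinuousLinearMap.proj (R := ℝ) (φ := fun _ : Fin 2 => ℝ) k).hasFDerivAt.fderiv
  simp only [pdDer_apply, pd, coordFun, this]
  by_cases h : j = k
  · simp [h]
  · simp [h]

lemma hasFDerivAt_normSqFun (z : Fin 2 → ℝ) :
    HasFDerivAt normSqFun ((2 * z 0) • ContinuousLinearMap.proj (R := ℝ) (φ := fun _ : Fin 2 => ℝ) 0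
      + (2 * z 1) • ContinuousLinearMap.proj (R := ℝ) (φ := fun _ : Fin 2 => ℝ) 1) z := by
  have h := fun k : Fin 2 =>
    ((ContinuousLinearMap.proj (R := ℝ) (φ := fun _ : Fin 2 => ℝ) k).hasFDerivAt (x := z)).pow 2
  have := (h 0).add (h 1)
  refine this.congr_fderiv ?_
  ext v; simp

lemma pd_radial {g : ℝ → ℝ} {z : Fin 2 → ℝ} (k : Fin 2) {g' : ℝ}
    (hg : HasDerivAt g g' (normSqFun z)) :
    pd k (fun w => g (normSqFun w)) z = 2 * z k * g' := by
  have := (hg.comp_hasFDerivAt z (hasFDerivAt_normSqFun z)).fderiv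
  unfold pd
  rw [show (fun w => g (normSqFun w)) = g ∘ normSqFun from rfl, this]
  fin_cases k <;> simp <;> ring

lemma rotDer_twistFun : rotDer twistFun = 0 := by
  ext z
  have h := fun k => pd_radial (z := z) k (hasDerivAt_twistCoeff (normSqFun_nonneg z))
  simp [rotDer, pdDer_apply, twistFun, coordFun, h]
  ring

lemma pdDer_twistFun :
    coordFun 0 * pdDer 0 twistFun + coordFun 1 * pdDer 1 twistFun
      = -1 - 3 * twistFun + (coordFun 0 ^ 2 + coordFun 1 ^ 2) * twistFun ^ 2 := by
  ext z
  have h := fun k => pd_radial (z := z) k (hasDerivAt_twistCoeff (normSqFun_nonneg z))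
  have ode := twistCoeff_ode (normSqFun_nonneg z)
  have h3 : ((3 : smoothFun) : (Fin 2 → ℝ) → ℝ) z = 3 := rfl
  simp only [pdDer_apply, twistFun, coordFun, Subalgebra.coe_add, Subalgebra.coe_mul, Pi.add_apply,
    Pi.mul_apply, Subalgebra.coe_sub, Pi.sub_apply, Subalgebra.coe_neg, Pi.neg_apply,
    Subalgebra.coe_one, Pi.one_apply, Subalgebra.coe_pow, Pi.pow_apply, h, h3]
  have h2 : normSqFun z = z 0 ^ 2 + z 1 ^ 2 := rfl
  rw [← h2]
  rw [← ode]
  rw [h2]; ring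

lemma gammaDer_comm_01 (F : smoothFun) :
    gammaDer 0 (gammaDer 1 F) = gammaDer 1 (gammaDer 0 F) + gammaDer 2 F := by
  have hr := rotDer_twistFun
  have hp := pdDer_twistFun
  have hc := pdDer_comm F
  simp only [rotDer, Derivation.sub_apply, Derivation.smul_apply, smul_eq_mul] at hr
  simp [gammaDer, rotDer, Derivation.leibniz, pdDer_coordFun]
  linear_combination (1 - twistFun * (coordFun 0 ^ 2 + coordFun 1 ^ 2)) * hc
    - (coordFun 0 * pdDer 1 F - coordFun 1 * pdDer 0 F) * hp

lemma gammaDer_comm_20 (F : smoothFun) :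
    gammaDer 2 (gammaDer 0 F) = gammaDer 0 (gammaDer 2 F) - gammaDer 1 F := by
  have hr := rotDer_twistFun
  have hc := pdDer_comm F
  simp only [rotDer, Derivation.sub_apply, Derivation.smul_apply, smul_eq_mul] at hr
  simp [gammaDer, rotDer, Derivation.leibniz, pdDer_coordFun]
  linear_combination (-coordFun 0) * hc
    + coordFun 1 * (coordFun 0 * pdDer 1 F - coordFun 1 * pdDer 0 F) * hr

lemma gammaDer_comm_21 (F : smoothFun) :
    gammaDer 2 (gammaDer 1 F) = gammaDer 1 (gammaDer 2 F) + gammaDer 0 F := by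
  have hr := rotDer_twistFun
  have hc := pdDer_comm F
  simp only [rotDer, Derivation.sub_apply, Derivation.smul_apply, smul_eq_mul] at hr
  simp [gammaDer, rotDer, Derivation.leibniz, pdDer_coordFun]
  linear_combination (-coordFun 1) * hc
    - coordFun 0 * (coordFun 0 * pdDer 1 F - coordFun 1 * pdDer 0 F) * hr

/-- The fields `Γ₁, Γ₂, Γ₃` as elements of the endomorphism ring of the smooth functions. -/
def gammaEnd (i : Fin 3) : Module.End ℝ smoothFun := (gammaDer i : smoothFun →ₗ[ℝ] smoothFun)

lemma gammaEnd_apply (i : Fin 3) (F : smoothFun) : gammaEnd i F = gammaDer i F := rfl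

/-- The composition `Γ_{i₁} ⋯ Γ_{iₙ}` attached to a word `[i₁, …, iₙ]`. -/
def wordOp (l : List (Fin 3)) : Module.End ℝ smoothFun := (l.map gammaEnd).prod

@[simp] lemma wordOp_nil : wordOp [] = 1 := rfl

lemma wordOp_cons (k : Fin 3) (l : List (Fin 3)) : wordOp (k :: l) = gammaEnd k * wordOp l := by
  simp [wordOp]

lemma wordOp_append (l l' : List (Fin 3)) : wordOp (l ++ l') = wordOp l * wordOp l' := by
  simp [wordOp]

/-- The ordered composition `Γ₁^{I₁} Γ₂^{I₂} Γ₃^{I₃}`. -/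
def orderedOp (I : ℕ × ℕ × ℕ) : Module.End ℝ smoothFun :=
  gammaEnd 0 ^ I.1 * gammaEnd 1 ^ I.2.1 * gammaEnd 2 ^ I.2.2

lemma iterate_GammaOp (i : Fin 3) (n : ℕ) (F : smoothFun) :
    (GammaOp i)^[n] (F : (Fin 2 → ℝ) → ℝ) = ((gammaEnd i ^ n) F : smoothFun) := by
  induction n with
  | zero => rfl
  | succ n ih =>
    rw [Function.iterate_succ_apply', ih, pow_succ', Module.End.mul_apply, gammaEnd_apply,
      gammaDer_apply]

lemma GammaI_eq (I : ℕ × ℕ × ℕ) (F : smoothFun) :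
    GammaI I (F : (Fin 2 → ℝ) → ℝ) = (orderedOp I F : smoothFun) := by
  simp only [GammaI, iterate_GammaOp]
  rfl

lemma orderedOp_eq_wordOp (I : ℕ × ℕ × ℕ) :
    orderedOp I = wordOp (List.replicate I.1 0 ++ List.replicate I.2.1 1
      ++ List.replicate I.2.2 2) := by
  simp [orderedOp, wordOp, mul_assoc]

/-- The span of the ordered compositions of order at most `n`. -/
def orderedSpan (n : ℕ) : Submodule ℝ (Module.End ℝ smoothFun) :=
  Submodule.span ℝ (orderedOp '' {I | I.1 + I.2.1 + I.2.2 ≤ n})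

lemma orderedOp_mem_orderedSpan {I : ℕ × ℕ × ℕ} {n : ℕ} (h : I.1 + I.2.1 + I.2.2 ≤ n) :
    orderedOp I ∈ orderedSpan n :=
  Submodule.subset_span ⟨I, h, rfl⟩

lemma orderedSpan_mono {m n : ℕ} (h : m ≤ n) : orderedSpan m ≤ orderedSpan n :=
  Submodule.span_mono (Set.image_mono fun _ hI => le_trans hI h)

lemma mul_mem_orderedSpan_of_forall {X : Module.End ℝ smoothFun} {m n : ℕ}
    (h : ∀ I : ℕ × ℕ × ℕ, I.1 + I.2.1 + I.2.2 ≤ n → X * orderedOp I ∈ orderedSpan m) :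
    ∀ T ∈ orderedSpan n, X * T ∈ orderedSpan m := by
  intro T hT
  refine Submodule.span_induction ?_ ?_ ?_ ?_ hT
  · rintro _ ⟨I, hI, rfl⟩; exact h I hI
  · simp
  · intro S T _ _ hS hT; rw [mul_add]; exact add_mem hS hT
  · intro c T _ hT; rw [mul_smul_comm]; exact Submodule.smul_mem _ c hT

lemma gammaEnd_comm_10 (T : Module.End ℝ smoothFun) :
    gammaEnd 1 * (gammaEnd 0 * T) = gammaEnd 0 * (gammaEnd 1 * T) + (-1 : ℝ) • (gammaEnd 2 * T) := by
  refine LinearMap.ext fun F => ?_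
  have := gammaDer_comm_01 (T F)
  simp [gammaEnd_apply, this]

lemma gammaEnd_comm_20 (T : Module.End ℝ smoothFun) :
    gammaEnd 2 * (gammaEnd 0 * T) = gammaEnd 0 * (gammaEnd 2 * T) + (-1 : ℝ) • (gammaEnd 1 * T) := by
  refine LinearMap.ext fun F => ?_
  have := gammaDer_comm_20 (T F)
  simp [gammaEnd_apply, this, sub_eq_add_neg]

lemma gammaEnd_comm_21 (T : Module.End ℝ smoothFun) :
    gammaEnd 2 * (gammaEnd 1 * T) = gammaEnd 1 * (gammaEnd 2 * T) + gammaEnd 0 * T :=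
  LinearMap.ext fun F => gammaDer_comm_21 (T F)

lemma gammaEnd_mul_mem_orderedSpan (n : ℕ) :
    ∀ i, ∀ T ∈ orderedSpan n, gammaEnd i * T ∈ orderedSpan (n + 1) := by
  induction n using Nat.strong_induction_on with
  | _ n ih =>
  have h0 : ∀ T ∈ orderedSpan n, gammaEnd 0 * T ∈ orderedSpan (n + 1) := by
    apply mul_mem_orderedSpan_of_forall
    intro I hI
    have : gammaEnd 0 * orderedOp I = orderedOp (I.1 + 1, I.2.1, I.2.2) := by
      simp [orderedOp, pow_succ', mul_assoc]
    rw [this]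
    exact orderedOp_mem_orderedSpan (by simp; omega)
  have split0 : ∀ a b c, orderedOp (a + 1, b, c) = gammaEnd 0 * orderedOp (a, b, c) := by
    intro a b c; simp [orderedOp, pow_succ', mul_assoc]
  have split1 : ∀ b c, orderedOp (0, b + 1, c) = gammaEnd 1 * orderedOp (0, b, c) := by
    intro b c; simp [orderedOp, pow_succ', mul_assoc]
  have split2 : ∀ c, orderedOp (0, 0, c + 1) = gammaEnd 2 * orderedOp (0, 0, c) := by
    intro c; simp [orderedOp, pow_succ']
  have h1 : ∀ T ∈ orderedSpan n, gammaEnd 1 * T ∈ orderedSpan (n + 1) := by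
    apply mul_mem_orderedSpan_of_forall
    rintro ⟨a, b, c⟩ hI
    simp only at hI
    rcases a with _ | a
    · rw [← split1]; exact orderedOp_mem_orderedSpan (by simp; omega)
    · obtain ⟨m, rfl⟩ : ∃ m, n = m + 1 := ⟨n - 1, by omega⟩
      have hm : orderedOp (a, b, c) ∈ orderedSpan m := orderedOp_mem_orderedSpan (by simp; omega)
      rw [split0, gammaEnd_comm_10]
      exact add_mem (h0 _ (ih m (by omega) 1 _ hm))
        (Submodule.smul_mem _ _ (orderedSpan_mono (by omega) (ih m (by omega) 2 _ hm)))
  have h2 : ∀ T ∈ orderedSpan n, gammaEnd 2 * T ∈ orderedSpan (n + 1) := by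
    apply mul_mem_orderedSpan_of_forall
    rintro ⟨a, b, c⟩ hI
    simp only at hI
    rcases a with _ | a
    · rcases b with _ | b
      · rw [← split2]; exact orderedOp_mem_orderedSpan (by simp; omega)
      · obtain ⟨m, rfl⟩ : ∃ m, n = m + 1 := ⟨n - 1, by omega⟩
        have hm : orderedOp (0, b, c) ∈ orderedSpan m :=
          orderedOp_mem_orderedSpan (by simp; omega)
        rw [split1, gammaEnd_comm_21]
        exact add_mem (h1 _ (ih m (by omega) 2 _ hm))
          (orderedSpan_mono (by omega) (ih m (by omega) 0 _ hm))
    · obtain ⟨m, rfl⟩ : ∃ m, n = m + 1 := ⟨n - 1, by omega⟩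
      have hm : orderedOp (a, b, c) ∈ orderedSpan m := orderedOp_mem_orderedSpan (by simp; omega)
      rw [split0, gammaEnd_comm_20]
      exact add_mem (h0 _ (ih m (by omega) 2 _ hm))
        (Submodule.smul_mem _ _ (orderedSpan_mono (by omega) (ih m (by omega) 1 _ hm)))
  intro i
  fin_cases i
  exacts [h0, h1, h2]

lemma wordOp_mem_orderedSpan (l : List (Fin 3)) : wordOp l ∈ orderedSpan l.length := by
  induction l with
  | nil => exact orderedOp_mem_orderedSpan (I := (0, 0, 0)) (by simp)
  | cons k l ih => rw [wordOp_cons]; exact gammaEnd_mul_mem_orderedSpan _ k _ ih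

lemma smoothFun.continuous (F : smoothFun) : Continuous (F : (Fin 2 → ℝ) → ℝ) :=
  (smoothFun.contDiff F).continuous

lemma eLpNorm_le_sNormE_of_mem_orderedSpan {n : ℕ} {T : Module.End ℝ smoothFun}
    (hT : T ∈ orderedSpan n) :
    ∃ C : ℝ≥0, ∀ F : smoothFun,
      eLpNorm (T F : (Fin 2 → ℝ) → ℝ) 2 Gmeasure ≤ C * sNormE n (F : (Fin 2 → ℝ) → ℝ) := by
  refine Submodule.span_induction ?_ ?_ ?_ ?_ hT
  · rintro _ ⟨I, hI, rfl⟩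
    refine ⟨1, fun F => ?_⟩
    rw [← GammaI_eq, ENNReal.coe_one, one_mul, sNormE]
    refine Finset.single_le_sum (f := fun I => eLpNorm (GammaI I (F : (Fin 2 → ℝ) → ℝ)) 2 Gmeasure)
      (fun _ _ => zero_le) ?_
    simp only [Set.mem_ofPred_eq] at hI
    simp [multiIndices]
    omega
  · exact ⟨0, fun F => by simp⟩
  · rintro S T - - ⟨A, hA⟩ ⟨B, hB⟩
    refine ⟨A + B, fun F => ?_⟩
    rw [LinearMap.add_apply, Subalgebra.coe_add, ENNReal.coe_add, add_mul]
    exact (eLpNorm_add_le (smoothFun.continuous _).aestronglyMeasurable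
      (smoothFun.continuous _).aestronglyMeasurable (by norm_num)).trans
      (add_le_add (hA F) (hB F))
  · rintro c T - ⟨A, hA⟩
    refine ⟨‖c‖₊ * A, fun F => ?_⟩
    rw [LinearMap.smul_apply, Subalgebra.coe_smul, eLpNorm_const_smul, ENNReal.coe_mul, mul_assoc]
    exact mul_le_mul_right (hA F) _

lemma eLpNorm_wordOp_le_sNormE (s : ℕ) (l : List (Fin 3)) (hl : l.length ≤ s) :
    ∃ C : ℝ≥0, ∀ F : smoothFun,
      eLpNorm (wordOp l F : (Fin 2 → ℝ) → ℝ) 2 Gmeasure ≤ C * sNormE s (F : (Fin 2 → ℝ) → ℝ) :=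
  eLpNorm_le_sNormE_of_mem_orderedSpan (orderedSpan_mono hl (wordOp_mem_orderedSpan l))

lemma continuous_density : Continuous fun z : Fin 2 → ℝ => sinhcSq (normSqFun z) :=
  contDiff_sinhcSq.continuous.comp contDiff_normSqFun.continuous

lemma Gmeasure_eq :
    Gmeasure = volume.withDensity fun z => ENNReal.ofReal (sinhcSq (normSqFun z)) := by
  simp only [Gmeasure, sqrt_Gfun]

instance : IsLocallyFiniteMeasure Gmeasure := by
  rw [Gmeasure_eq]
  exact IsLocallyFiniteMeasure.withDensity_ofReal continuous_density

lemma integral_Gmeasure (f : (Fin 2 → ℝ) → ℝ) :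
    ∫ z, f z ∂Gmeasure = ∫ z, sinhcSq (normSqFun z) * f z := by
  rw [Gmeasure_eq, integral_withDensity_eq_integral_toReal_smul]
  · refine integral_congr_ae (Eventually.of_forall fun z => ?_)
    simp [ENNReal.toReal_ofReal (sinhcSq_pos (normSqFun_nonneg z)).le]
  · exact continuous_density.measurable.ennreal_ofReal
  · exact Eventually.of_forall fun z => ENNReal.ofReal_lt_top

lemma integral_pd_eq_zero (k : Fin 2) {F : (Fin 2 → ℝ) → ℝ} (hF : ContDiff ℝ 1 F)
    (hc : HasCompactSupport F) : ∫ z, pd k F z = 0 := by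
  have h := integral_mul_fderiv_eq_neg_fderiv_mul_of_integrable (μ := (volume : Measure (Fin 2 → ℝ)))
    (f := fun _ => (1 : ℝ)) (g := F) (v := Pi.single k 1) (by simp) ?_ ?_ (by simp)
    (fun x _ => hF.differentiable (by simp) x)
  · simpa [pd] using h
  · simp only [one_mul]
    refine Continuous.integrable_of_hasCompactSupport ?_ ?_
    · exact (hF.continuous_fderiv (by simp)).clm_apply continuous_const
    · exact hc.fderiv_apply (𝕜 := ℝ) _
  · simpa using hF.continuous.integrable_of_hasCompactSupport hc

/-- The density `√G` as a smooth function. -/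
def densityFun : smoothFun :=
  ⟨fun z => sinhcSq (normSqFun z), contDiff_sinhcSq.comp contDiff_normSqFun⟩

/-- The derivative of the density with respect to `|z|²`, as a smooth function. -/
def densityDerivFun : smoothFun :=
  ⟨fun z => deriv sinhcSq (normSqFun z), contDiff_deriv_sinhcSq.comp contDiff_normSqFun⟩

lemma pdDer_densityFun (k : Fin 2) :
    pdDer k densityFun = 2 * coordFun k * densityDerivFun := by
  ext z
  exact pd_radial k (hasDerivAt_sinhcSq _)

lemma rotDer_densityDerivFun :
    coordFun 0 * pdDer 1 densityDerivFun = coordFun 1 * pdDer 0 densityDerivFun := by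
  ext z
  have h := fun k => pd_radial (z := z) k (hasDerivAt_deriv_sinhcSq (normSqFun z))
  simp [pdDer_apply, densityDerivFun, coordFun, h]
  ring

/-- The components of the field `√G Γᵢ`. -/
def fluxFun (i : Fin 3) (k : Fin 2) : smoothFun :=
  ![![densityFun + 2 * densityDerivFun * coordFun 1 ^ 2,
      -2 * densityDerivFun * coordFun 0 * coordFun 1],
    ![-2 * densityDerivFun * coordFun 0 * coordFun 1,
      densityFun + 2 * densityDerivFun * coordFun 0 ^ 2],
    ![-densityFun * coordFun 1, densityFun * coordFun 0]] i k

lemma div_fluxFun (i : Fin 3) : pdDer 0 (fluxFun i 0) + pdDer 1 (fluxFun i 1) = 0 := by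
  have h := rotDer_densityDerivFun
  have h2 : ∀ k, pdDer k 2 = 0 := fun k => by
    exact_mod_cast Derivation.map_natCast (pdDer k) 2
  fin_cases i
  · simp [fluxFun, Derivation.leibniz, Derivation.leibniz_pow, pdDer_densityFun, pdDer_coordFun, h2]
    linear_combination -2 * coordFun 1 * h
  · simp [fluxFun, Derivation.leibniz, Derivation.leibniz_pow, pdDer_densityFun, pdDer_coordFun, h2]
    linear_combination 2 * coordFun 0 * h
  · simp [fluxFun, Derivation.leibniz, pdDer_densityFun, pdDer_coordFun]
    ring

lemma density_mul_GammaOp (i : Fin 3) (F : (Fin 2 → ℝ) → ℝ) (z : Fin 2 → ℝ) :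
    sinhcSq (normSqFun z) * GammaOp i F z
      = (fluxFun i 0 : (Fin 2 → ℝ) → ℝ) z * pd 0 F z
        + (fluxFun i 1 : (Fin 2 → ℝ) → ℝ) z * pd 1 F z := by
  have h3 : ((2 : smoothFun) : (Fin 2 → ℝ) → ℝ) z = 2 := rfl
  have := (sinhcSq_pos (normSqFun_nonneg z)).ne'
  have hn : normSqFun z = z 0 ^ 2 + z 1 ^ 2 := rfl
  fin_cases i
  · simp [GammaOp, cmat_eq, fluxFun, densityFun, densityDerivFun, coordFun, h3, twistCoeff]
    field_simp
    rw [hn]; ring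
  · simp [GammaOp, cmat_eq, fluxFun, densityFun, densityDerivFun, coordFun, h3, twistCoeff]
    field_simp
    rw [hn]; ring
  · simp [GammaOp, fluxFun, densityFun, coordFun]
    ring

lemma integral_GammaOp_eq_zero (i : Fin 3) {F : (Fin 2 → ℝ) → ℝ} (hF : ContDiff ℝ 1 F)
    (hc : HasCompactSupport F) : ∫ z, GammaOp i F z ∂Gmeasure = 0 := by
  have hA : ∀ k, ContDiff ℝ 1 (fluxFun i k : (Fin 2 → ℝ) → ℝ) :=
    fun k => (smoothFun.contDiff _).of_le (by simp)
  have hprod : ∀ k, ContDiff ℝ 1 ((fluxFun i k : (Fin 2 → ℝ) → ℝ) * F) := fun k => (hA k).mul hF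
  have hsupp : ∀ k, HasCompactSupport ((fluxFun i k : (Fin 2 → ℝ) → ℝ) * F) :=
    fun k => hc.mul_left
  have h_intg : ∀ k, Integrable (pd k ((fluxFun i k : (Fin 2 → ℝ) → ℝ) * F)) := fun k =>
    Continuous.integrable_of_hasCompactSupport
      (((hprod k).continuous_fderiv (by simp)).clm_apply continuous_const)
      ((hsupp k).fderiv_apply (𝕜 := ℝ) _)
  rw [integral_Gmeasure]
  have key : ∀ z, sinhcSq (normSqFun z) * GammaOp i F z
      = pd 0 ((fluxFun i 0 : (Fin 2 → ℝ) → ℝ) * F) z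
        + pd 1 ((fluxFun i 1 : (Fin 2 → ℝ) → ℝ) * F) z := by
    intro z
    have hd := congrFun (congrArg Subtype.val (div_fluxFun i)) z
    simp only [Subalgebra.coe_add, Pi.add_apply, pdDer_apply, Subalgebra.coe_zero,
      Pi.zero_apply] at hd
    have hm : ∀ k, pd k ((fluxFun i k : (Fin 2 → ℝ) → ℝ) * F) z
        = (fluxFun i k : (Fin 2 → ℝ) → ℝ) z * pd k F z
          + F z * pd k (fluxFun i k : (Fin 2 → ℝ) → ℝ) z := by
      intro k
      simp [pd, fderiv_mul ((hA k).differentiable (by simp) z) (hF.differentiable (by simp) z)]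
    rw [density_mul_GammaOp, hm, hm]
    linear_combination (-F z) * hd
  simp_rw [key]
  rw [integral_add (h_intg 0) (h_intg 1), integral_pd_eq_zero 0 (hprod 0) (hsupp 0),
    integral_pd_eq_zero 1 (hprod 1) (hsupp 1), add_zero]

lemma hasDerivAt_mul_abs_rpow {p : ℝ} (hp : 0 < p) (x : ℝ) :
    HasDerivAt (fun x : ℝ => x * |x| ^ p) ((p + 1) * |x| ^ p) x := by
  rcases eq_or_ne x 0 with rfl | hx
  · rw [hasDerivAt_iff_tendsto_slope_zero]
    simp only [zero_add, abs_zero, Real.zero_rpow hp.ne', mul_zero, sub_zero, smul_eq_mul]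
    have : Tendsto (fun t : ℝ => |t| ^ p) (nhdsWithin 0 {0}ᶜ) (nhds 0) := by
      have h : Continuous fun t : ℝ => |t| ^ p := continuous_abs.rpow_const fun _ => Or.inr hp.le
      have := h.tendsto 0
      simp only [abs_zero, Real.zero_rpow hp.ne'] at this
      exact this.mono_left nhdsWithin_le_nhds
    refine this.congr' ?_
    filter_upwards [self_mem_nhdsWithin] with t ht
    have ht : t ≠ 0 := ht
    field_simp
  · have h1 := (hasDerivAt_abs hx).rpow_const (p := p) (Or.inl (abs_ne_zero.2 hx))
    have h2 := (hasDerivAt_id x).mul h1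
    refine h2.congr_deriv ?_
    have hs : x * (SignType.sign x : ℝ) = |x| := by
      rw [mul_comm]; exact sign_mul_self x
    have hpow : |x| * |x| ^ (p - 1) = |x| ^ p := by
      rw [Real.rpow_sub_one (abs_ne_zero.2 hx)]
      have := abs_ne_zero.2 hx
      field_simp
    simp only [id_eq]
    linear_combination (p * |x| ^ (p - 1)) * hs + p * hpow

lemma contDiff_mul_abs_rpow {p : ℝ} (hp : 0 < p) :
    ContDiff ℝ 1 (fun x : ℝ => x * |x| ^ p) := by
  rw [contDiff_one_iff_deriv]
  refine ⟨fun x => (hasDerivAt_mul_abs_rpow hp x).differentiableAt, ?_⟩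
  rw [funext fun x => (hasDerivAt_mul_abs_rpow hp x).deriv]
  exact continuous_const.mul (continuous_abs.rpow_const fun _ => Or.inr hp.le)

lemma GammaOp_mul (i : Fin 3) {F G : (Fin 2 → ℝ) → ℝ} {z : Fin 2 → ℝ}
    (hF : DifferentiableAt ℝ F z) (hG : DifferentiableAt ℝ G z) :
    GammaOp i (fun w => F w * G w) z = F z * GammaOp i G z + GammaOp i F z * G z := by
  have h : ∀ k, pd k (fun w => F w * G w) z = F z * pd k G z + pd k F z * G z := by
    intro k; simp [pd, fderiv_fun_mul hF hG, mul_comm]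
  unfold GammaOp
  split_ifs <;> simp only [Fin.sum_univ_two, h] <;> ring

lemma GammaOp_comp (i : Fin 3) {F : (Fin 2 → ℝ) → ℝ} {g : ℝ → ℝ} {g' : ℝ} {z : Fin 2 → ℝ}
    (hg : HasDerivAt g g' (F z)) (hF : DifferentiableAt ℝ F z) :
    GammaOp i (fun w => g (F w)) z = g' * GammaOp i F z := by
  have h : ∀ k, pd k (fun w => g (F w)) z = g' * pd k F z := by
    intro k
    have := (hg.comp_hasFDerivAt z hF.hasFDerivAt).fderiv
    unfold pd
    rw [show (fun w => g (F w)) = g ∘ F from rfl, this]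
    simp
  unfold GammaOp
  split_ifs <;> simp only [Fin.sum_univ_two, h] <;> ring

lemma HasCompactSupport.gammaDer {F : smoothFun}
    (hF : HasCompactSupport (F : (Fin 2 → ℝ) → ℝ)) (i : Fin 3) :
    HasCompactSupport (_root_.gammaDer i F : (Fin 2 → ℝ) → ℝ) := by
  have hpd : ∀ k, HasCompactSupport (pd k (F : (Fin 2 → ℝ) → ℝ)) :=
    fun k => hF.fderiv_apply (𝕜 := ℝ) _
  rw [gammaDer_apply]
  refine (hpd 0).union (hpd 1) |>.of_isClosed_subset (isClosed_tsupport _) ?_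
  refine closure_minimal ?_ ((isClosed_tsupport _).union (isClosed_tsupport _))
  intro z hz
  by_contra hcon
  simp only [Set.mem_union, not_or] at hcon
  have h0 : pd 0 (F : (Fin 2 → ℝ) → ℝ) z = 0 := image_eq_zero_of_notMem_tsupport hcon.1
  have h1 : pd 1 (F : (Fin 2 → ℝ) → ℝ) z = 0 := image_eq_zero_of_notMem_tsupport hcon.2
  apply hz
  unfold GammaOp
  split_ifs <;> simp [h0, h1]

lemma HasCompactSupport.wordOp {F : smoothFun}
    (hF : HasCompactSupport (F : (Fin 2 → ℝ) → ℝ)) (l : List (Fin 3)) :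
    HasCompactSupport (_root_.wordOp l F : (Fin 2 → ℝ) → ℝ) := by
  induction l with
  | nil => exact hF
  | cons k l ih => rw [wordOp_cons]; exact ih.gammaDer k

lemma integral_abs_gammaDer_rpow_le {p : ℝ} (hp : 0 < p) (i : Fin 3) {w : smoothFun}
    (hw : HasCompactSupport (w : (Fin 2 → ℝ) → ℝ)) :
    ∫ z, |(gammaDer i w : (Fin 2 → ℝ) → ℝ) z| ^ (p + 2) ∂Gmeasure
      ≤ (p + 1) * ∫ z, |(w : (Fin 2 → ℝ) → ℝ) z| * |(gammaDer i w : (Fin 2 → ℝ) → ℝ) z| ^ p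
          * |(gammaDer i (gammaDer i w) : (Fin 2 → ℝ) → ℝ) z| ∂Gmeasure := by
  set f : (Fin 2 → ℝ) → ℝ := (gammaDer i w : (Fin 2 → ℝ) → ℝ) with hf
  set f2 : (Fin 2 → ℝ) → ℝ := (gammaDer i (gammaDer i w) : (Fin 2 → ℝ) → ℝ) with hf2
  have hfc : Continuous f := smoothFun.continuous _
  have hf2c : Continuous f2 := smoothFun.continuous _
  have hwc : Continuous (w : (Fin 2 → ℝ) → ℝ) := smoothFun.continuous _
  have hfs : HasCompactSupport f := hw.gammaDer i
  have hpow : Continuous fun z => |f z| ^ p := hfc.abs.rpow_const fun _ => Or.inr hp.le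
  have hC : ContDiff ℝ 1 (fun z => f z * |f z| ^ p) :=
    (contDiff_mul_abs_rpow hp).comp ((smoothFun.contDiff (gammaDer i w)).of_le (by simp))
  have hwC : ContDiff ℝ 1 (w : (Fin 2 → ℝ) → ℝ) := (smoothFun.contDiff w).of_le (by simp)
  have hzero := integral_GammaOp_eq_zero i (hwC.mul hC) (hw.mul_right)
  have hexp : ∀ z, GammaOp i (fun z => (w : (Fin 2 → ℝ) → ℝ) z * (f z * |f z| ^ p)) z
      = |f z| ^ (p + 2) + (p + 1) * ((w : (Fin 2 → ℝ) → ℝ) z * |f z| ^ p * f2 z) := by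
    intro z
    rw [GammaOp_mul i (smoothFun.differentiable w z) (hC.differentiable (by simp) z),
      GammaOp_comp i (g := fun x => x * |x| ^ p) (hasDerivAt_mul_abs_rpow hp (f z))
        (smoothFun.differentiable (gammaDer i w) z), ← gammaDer_apply i w, ← hf]
    rw [hf, ← gammaDer_apply, ← hf2, ← hf]
    have : |f z| ^ (p + 2) = |f z| ^ p * (f z * f z) := by
      rw [Real.rpow_add_of_nonneg (abs_nonneg _) hp.le (by norm_num), Real.rpow_two, sq_abs, sq]
    rw [this]; ring
  have h_intg1 : Integrable (fun z => |f z| ^ (p + 2)) Gmeasure := by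
    refine Continuous.integrable_of_hasCompactSupport
      (hfc.abs.rpow_const fun _ => Or.inr (by linarith)) ?_
    exact hfs.comp_left (g := fun x => |x| ^ (p + 2))
      (by rw [abs_zero]; exact Real.zero_rpow (by linarith))
  have h_intg2 : Integrable (fun z => (w : (Fin 2 → ℝ) → ℝ) z * |f z| ^ p * f2 z) Gmeasure :=
    Continuous.integrable_of_hasCompactSupport ((hwc.mul hpow).mul hf2c)
      ((hw.mul_right).mul_right)
  have hsum : ∫ z, |f z| ^ (p + 2) ∂Gmeasure
      + (p + 1) * ∫ z, (w : (Fin 2 → ℝ) → ℝ) z * |f z| ^ p * f2 z ∂Gmeasure = 0 := by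
    rw [← integral_const_mul, ← integral_add h_intg1 (h_intg2.const_mul _), ← hzero]
    exact integral_congr_ae (Eventually.of_forall fun z => (hexp z).symm)
  have habs : -∫ z, (w : (Fin 2 → ℝ) → ℝ) z * |f z| ^ p * f2 z ∂Gmeasure
      ≤ ∫ z, |(w : (Fin 2 → ℝ) → ℝ) z| * |f z| ^ p * |f2 z| ∂Gmeasure := by
    refine (neg_le_abs _).trans ((abs_integral_le_integral_abs).trans_eq ?_)
    refine integral_congr_ae (Eventually.of_forall fun z => ?_)
    simp only [abs_mul, abs_of_nonneg (Real.rpow_nonneg (abs_nonneg (f z)) p)]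
  nlinarith [mul_le_mul_of_nonneg_left habs (by linarith : 0 ≤ p + 1)]

/-- The words of length `n` in the letters `0, 1, 2`. -/
def words (n : ℕ) : Finset (List (Fin 3)) := (List.finite_length_eq (Fin 3) n).toFinset

@[simp] lemma mem_words {n : ℕ} {l : List (Fin 3)} : l ∈ words n ↔ l.length = n := by
  simp [words]

lemma rpow_mul_rpow_mul_rpow_le {w₁ w₂ w₃ : ℝ} (h₁ : 0 ≤ w₁) (h₂ : 0 ≤ w₂) (h₃ : 0 < w₃)
    (hw : w₁ + w₂ + w₃ = 1) {δ : ℝ} (hδ : 0 < δ) :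
    ∃ C : ℝ, 0 ≤ C ∧ ∀ x y z : ℝ, 0 ≤ x → 0 ≤ y → 0 ≤ z →
      x ^ w₁ * y ^ w₂ * z ^ w₃ ≤ δ * x + δ * y + C * z := by
  set c : ℝ := δ ^ (-(w₁ + w₂) / w₃) with hc
  have hc0 : 0 < c := Real.rpow_pos_of_pos hδ _
  refine ⟨c, hc0.le, fun x y z hx hy hz => ?_⟩
  have h := Real.geom_mean_le_arith_mean3_weighted h₁ h₂ h₃.le (mul_nonneg hδ.le hx)
    (mul_nonneg hδ.le hy) (mul_nonneg hc0.le hz) hw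
  rw [Real.mul_rpow hδ.le hx, Real.mul_rpow hδ.le hy, Real.mul_rpow hc0.le hz] at h
  have hone : δ ^ w₁ * δ ^ w₂ * c ^ w₃ = 1 := by
    rw [hc, ← Real.rpow_mul hδ.le, ← Real.rpow_add hδ, ← Real.rpow_add hδ,
      div_mul_cancel₀ _ h₃.ne', add_neg_cancel, Real.rpow_zero]
  calc x ^ w₁ * y ^ w₂ * z ^ w₃ = δ ^ w₁ * x ^ w₁ * (δ ^ w₂ * y ^ w₂) * (c ^ w₃ * z ^ w₃) := by
        linear_combination (-(x ^ w₁ * y ^ w₂ * z ^ w₃)) * hone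
    _ ≤ _ := h
    _ ≤ δ * x + δ * y + c * z := by
        refine add_le_add (add_le_add ?_ ?_) ?_
        · exact mul_le_of_le_one_left (mul_nonneg hδ.le hx) (by linarith)
        · exact mul_le_of_le_one_left (mul_nonneg hδ.le hy) (by linarith)
        · exact mul_le_of_le_one_left (mul_nonneg hc0.le hz) (by linarith)

/-- `|Γ^l u|^{2k/|l|}`, set to `0` for the empty word. -/
def gnFun (k : ℕ) (l : List (Fin 3)) (u : smoothFun) (z : Fin 2 → ℝ) : ℝ :=
  if l = [] then 0 else |(wordOp l u : (Fin 2 → ℝ) → ℝ) z| ^ (2 * (k : ℝ) / l.length)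

lemma gnFun_nonneg (k : ℕ) (l : List (Fin 3)) (u : smoothFun) (z : Fin 2 → ℝ) :
    0 ≤ gnFun k l u z := by
  unfold gnFun; split_ifs <;> positivity

lemma integrable_gnFun {k : ℕ} (hk : 0 < k) (l : List (Fin 3)) {u : smoothFun}
    (hu : HasCompactSupport (u : (Fin 2 → ℝ) → ℝ)) : Integrable (gnFun k l u) Gmeasure := by
  unfold gnFun
  by_cases hl : l = []
  · simp [hl]
  · have hpos : 0 < 2 * (k : ℝ) / l.length := by
      have : 0 < l.length := List.length_pos_iff.2 hl
      positivity
    simp only [hl, if_false]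
    refine Continuous.integrable_of_hasCompactSupport
      ((smoothFun.continuous _).abs.rpow_const fun _ => Or.inr hpos.le) ?_
    exact (hu.wordOp l).comp_left (g := fun x => |x| ^ (2 * (k : ℝ) / l.length))
      (by rw [abs_zero]; exact Real.zero_rpow hpos.ne')

/-- The integrals `∫ |Γ^l u|^{2k/j}` summed over the words of length `j`. -/
def gnSum (k j : ℕ) (u : smoothFun) : ℝ := ∑ l ∈ words j, ∫ z, gnFun k l u z ∂Gmeasure

lemma integral_gnFun_nonneg (k : ℕ) (l : List (Fin 3)) (u : smoothFun) :
    0 ≤ ∫ z, gnFun k l u z ∂Gmeasure := integral_nonneg fun z => gnFun_nonneg k l u z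

lemma gnSum_nonneg (k j : ℕ) (u : smoothFun) : 0 ≤ gnSum k j u :=
  Finset.sum_nonneg fun l _ => integral_gnFun_nonneg k l u

lemma integral_gnFun_le_gnSum (k : ℕ) (l : List (Fin 3)) (u : smoothFun) :
    ∫ z, gnFun k l u z ∂Gmeasure ≤ gnSum k l.length u :=
  Finset.single_le_sum (f := fun l => ∫ z, gnFun k l u z ∂Gmeasure)
    (fun l _ => integral_gnFun_nonneg k l u) (mem_words.2 rfl)

lemma integral_gnFun_cons_le {k n : ℕ} (hn : n + 1 < k) {δ : ℝ} (hδ : 0 < δ) :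
    ∃ C : ℝ, 0 ≤ C ∧ ∀ u : smoothFun, HasCompactSupport (u : (Fin 2 → ℝ) → ℝ) →
      (∀ z, |(u : (Fin 2 → ℝ) → ℝ) z| ≤ 1) → ∀ (i : Fin 3) (l : List (Fin 3)), l.length = n →
      ∫ z, gnFun k (i :: l) u z ∂Gmeasure ≤ δ * ∫ z, gnFun k l u z ∂Gmeasure
        + δ * ∫ z, gnFun k (i :: l) u z ∂Gmeasure
        + C * ∫ z, gnFun k (i :: i :: l) u z ∂Gmeasure := by
  have hk : (0 : ℝ) < k := by exact_mod_cast (by omega : 0 < k)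
  have hn1 : (0 : ℝ) < n + 1 := by positivity
  have hnk : (n : ℝ) + 1 < k := by exact_mod_cast hn
  set p : ℝ := 2 * k / (n + 1) - 2 with hp
  have hp0 : 0 < p := by
    rw [hp, sub_pos, lt_div_iff₀ hn1]; linarith
  obtain ⟨C, hC, hY⟩ := rpow_mul_rpow_mul_rpow_le (w₁ := n / (2 * k)) (w₂ := 1 - (n + 1) / k)
    (w₃ := (n + 2) / (2 * k)) (by positivity) (by rw [sub_nonneg, div_le_one hk]; exact hnk.le)
    (by positivity) (by field_simp; ring) (δ := δ / (p + 1)) (by positivity)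
  refine ⟨(p + 1) * C, by positivity, fun u hu hu1 i l hl => ?_⟩
  have hI := integral_abs_gammaDer_rpow_le hp0 i (hu.wordOp l)
  set f0 : (Fin 2 → ℝ) → ℝ := (wordOp l u : (Fin 2 → ℝ) → ℝ) with hf0
  have e1 : (gammaDer i (wordOp l u) : smoothFun) = wordOp (i :: l) u := by
    rw [wordOp_cons]; rfl
  have e2 : (gammaDer i (wordOp (i :: l) u) : smoothFun) = wordOp (i :: i :: l) u := by
    rw [wordOp_cons i (i :: l)]; rfl
  rw [e1, e2] at hI
  set f1 : (Fin 2 → ℝ) → ℝ := (wordOp (i :: l) u : (Fin 2 → ℝ) → ℝ) with hf1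
  set f2 : (Fin 2 → ℝ) → ℝ := (wordOp (i :: i :: l) u : (Fin 2 → ℝ) → ℝ) with hf2
  have g1 : ∀ z, gnFun k (i :: l) u z = |f1 z| ^ (2 * (k : ℝ) / (n + 1)) := by
    intro z; simp [gnFun, hl, hf1]
  have g2 : ∀ z, gnFun k (i :: i :: l) u z = |f2 z| ^ (2 * (k : ℝ) / (n + 2)) := by
    intro z; simp [gnFun, hl, hf2, add_assoc, one_add_one_eq_two]
  have hpt : ∀ z, |f0 z| * |f1 z| ^ p * |f2 z| ≤ δ / (p + 1) * gnFun k l u z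
      + δ / (p + 1) * gnFun k (i :: l) u z + C * gnFun k (i :: i :: l) u z := by
    intro z
    refine le_trans ?_ (hY _ _ _ (gnFun_nonneg k l u z) (gnFun_nonneg k (i :: l) u z)
      (gnFun_nonneg k (i :: i :: l) u z))
    have a0 : |f0 z| ≤ gnFun k l u z ^ ((n : ℝ) / (2 * k)) := by
      by_cases hnil : l = []
      · subst hnil
        have : n = 0 := by simpa using hl.symm
        subst this
        simpa [hf0] using hu1 z
      · have : (n : ℝ) ≠ 0 := by
          rw [← hl]; exact_mod_cast (List.length_pos_iff.2 hnil).ne'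
        rw [gnFun, if_neg hnil, ← Real.rpow_mul (abs_nonneg _), hl, ← hf0,
          show 2 * (k : ℝ) / n * (n / (2 * k)) = 1 by field_simp, Real.rpow_one]
    have a1 : |f1 z| ^ p = gnFun k (i :: l) u z ^ (1 - ((n : ℝ) + 1) / k) := by
      rw [g1, ← Real.rpow_mul (abs_nonneg _)]
      congr 1
      rw [hp]; field_simp
    have a2 : |f2 z| = gnFun k (i :: i :: l) u z ^ (((n : ℝ) + 2) / (2 * k)) := by
      rw [g2, ← Real.rpow_mul (abs_nonneg _),
        show 2 * (k : ℝ) / (n + 2) * ((n + 2) / (2 * k)) = 1 by field_simp, Real.rpow_one]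
    rw [a1, a2]
    have := Real.rpow_nonneg (gnFun_nonneg k (i :: l) u z) (1 - ((n : ℝ) + 1) / k)
    have := Real.rpow_nonneg (gnFun_nonneg k (i :: i :: l) u z) (((n : ℝ) + 2) / (2 * k))
    gcongr
  have hk' : 0 < k := by omega
  have i0 := integrable_gnFun hk' l hu
  have i1 := integrable_gnFun hk' (i :: l) hu
  have i2 := integrable_gnFun hk' (i :: i :: l) hu
  have hle : ∫ z, |f0 z| * |f1 z| ^ p * |f2 z| ∂Gmeasure
      ≤ δ / (p + 1) * ∫ z, gnFun k l u z ∂Gmeasure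
        + δ / (p + 1) * ∫ z, gnFun k (i :: l) u z ∂Gmeasure
        + C * ∫ z, gnFun k (i :: i :: l) u z ∂Gmeasure := by
    rw [← integral_const_mul, ← integral_const_mul, ← integral_const_mul,
      ← integral_add (i0.const_mul _) (i1.const_mul _),
      ← integral_add (f := fun z => δ / (p + 1) * gnFun k l u z
        + δ / (p + 1) * gnFun k (i :: l) u z) ((i0.const_mul _).add (i1.const_mul _))
        (i2.const_mul _)]
    refine integral_mono_of_nonneg (Eventually.of_forall fun z => by positivity)
      (((i0.const_mul _).add (i1.const_mul _)).add (i2.const_mul _)) (Eventually.of_forall hpt)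
  have hstart : ∫ z, gnFun k (i :: l) u z ∂Gmeasure = ∫ z, |f1 z| ^ (p + 2) ∂Gmeasure := by
    simp_rw [g1, hp]; simp
  rw [hstart]
  refine hI.trans ((mul_le_mul_of_nonneg_left hle (by positivity)).trans_eq ?_)
  rw [hstart]
  field_simp

lemma gnSum_succ_le {k n : ℕ} (hn : n + 1 < k) {δ : ℝ} (hδ : 0 < δ) :
    ∃ C : ℝ, 0 ≤ C ∧ ∀ u : smoothFun, HasCompactSupport (u : (Fin 2 → ℝ) → ℝ) →
      (∀ z, |(u : (Fin 2 → ℝ) → ℝ) z| ≤ 1) →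
      gnSum k (n + 1) u ≤ δ * gnSum k n u + C * gnSum k (n + 2) u := by
  set N : ℝ := ((words (n + 1)).card : ℝ) with hN
  have hN0 : 0 ≤ N := by positivity
  set ε : ℝ := min (1 / 2) (δ / 2) / (N + 1) with hε
  have hmin : 0 < min (1 / 2) (δ / 2) := lt_min (by norm_num) (by positivity)
  have hε0 : 0 < ε := by positivity
  have hNε : N * ε ≤ min (1 / 2) (δ / 2) := by
    rw [hε, mul_div_assoc', div_le_iff₀ (by positivity)]
    nlinarith
  obtain ⟨C, hC, h⟩ := integral_gnFun_cons_le hn hε0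
  refine ⟨2 * (N * C), by positivity, fun u hu hu1 => ?_⟩
  have key : gnSum k (n + 1) u
      ≤ N * (ε * gnSum k n u + ε * gnSum k (n + 1) u + C * gnSum k (n + 2) u) := by
    rw [hN, ← nsmul_eq_mul]
    refine Finset.sum_le_card_nsmul _ _ _ fun l hl => ?_
    rw [mem_words] at hl
    obtain ⟨i, l, rfl⟩ := List.exists_cons_of_length_eq_add_one hl
    have hl' : l.length = n := by simpa using hl
    refine (h u hu hu1 i l hl').trans ?_
    have b0 := integral_gnFun_le_gnSum k l u
    have b1 := integral_gnFun_le_gnSum k (i :: l) u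
    have b2 := integral_gnFun_le_gnSum k (i :: i :: l) u
    rw [hl'] at b0
    rw [hl] at b1
    rw [show (i :: i :: l).length = n + 2 by simp [hl']] at b2
    gcongr
  have h0 := gnSum_nonneg k n u
  have h1 := gnSum_nonneg k (n + 1) u
  have c0 := mul_le_mul_of_nonneg_right (hNε.trans (min_le_right _ _)) h0
  have c1 := mul_le_mul_of_nonneg_right (hNε.trans (min_le_left _ _)) h1
  linarith

lemma gnSum_le_succ {k : ℕ} (n : ℕ) (hn : n < k) :
    ∃ C : ℝ, 0 ≤ C ∧ ∀ u : smoothFun, HasCompactSupport (u : (Fin 2 → ℝ) → ℝ) →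
      (∀ z, |(u : (Fin 2 → ℝ) → ℝ) z| ≤ 1) → gnSum k n u ≤ C * gnSum k (n + 1) u := by
  induction n with
  | zero =>
    refine ⟨0, le_rfl, fun u _ _ => ?_⟩
    rw [zero_mul, gnSum]
    refine (Finset.sum_eq_zero fun l hl => ?_).le
    have : l = [] := by simpa using hl
    simp [gnFun, this]
  | succ n ih =>
    obtain ⟨C, hC, h⟩ := ih (by omega)
    obtain ⟨C', hC', h'⟩ := gnSum_succ_le hn (δ := 1 / (2 * (C + 1))) (by positivity)
    refine ⟨2 * C', by positivity, fun u hu hu1 => ?_⟩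
    have a := h u hu hu1
    have b := h' u hu hu1
    have h1 := gnSum_nonneg k (n + 1) u
    have c : 1 / (2 * (C + 1)) * gnSum k n u ≤ 1 / 2 * gnSum k (n + 1) u := by
      rw [one_div_mul_eq_div, div_le_iff₀ (by positivity)]
      nlinarith
    linarith

lemma gnSum_le_gnSum_self {k n : ℕ} (hn : n ≤ k) :
    ∃ C : ℝ, 0 ≤ C ∧ ∀ u : smoothFun, HasCompactSupport (u : (Fin 2 → ℝ) → ℝ) →
      (∀ z, |(u : (Fin 2 → ℝ) → ℝ) z| ≤ 1) → gnSum k n u ≤ C * gnSum k k u := by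
  induction hn using Nat.decreasingInduction with
  | self => exact ⟨1, zero_le_one, fun u _ _ => by rw [one_mul]⟩
  | of_succ n hn ih =>
    obtain ⟨C, hC, h⟩ := ih
    obtain ⟨C', hC', h'⟩ := gnSum_le_succ n hn
    refine ⟨C' * C, by positivity, fun u hu hu1 => (h' u hu hu1).trans ?_⟩
    rw [mul_assoc]
    exact mul_le_mul_of_nonneg_left (h u hu hu1) hC'

/-- The homogeneous energy `∑_{|l| = m} ‖Γ^l u‖²_{L²}`. -/
def sqSum (m : ℕ) (u : smoothFun) : ℝ :=
  ∑ l ∈ words m, ∫ z, (wordOp l u : (Fin 2 → ℝ) → ℝ) z ^ 2 ∂Gmeasure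

lemma sqSum_nonneg (m : ℕ) (u : smoothFun) : 0 ≤ sqSum m u :=
  Finset.sum_nonneg fun _ _ => integral_nonneg fun _ => sq_nonneg _

lemma integral_sq_le_sqSum (l : List (Fin 3)) (u : smoothFun) :
    ∫ z, (wordOp l u : (Fin 2 → ℝ) → ℝ) z ^ 2 ∂Gmeasure ≤ sqSum l.length u :=
  Finset.single_le_sum (f := fun l => ∫ z, (wordOp l u : (Fin 2 → ℝ) → ℝ) z ^ 2 ∂Gmeasure)
    (fun _ _ => integral_nonneg fun _ => sq_nonneg _) (mem_words.2 rfl)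

lemma gnSum_self {m : ℕ} (hm : 0 < m) (u : smoothFun) : gnSum m m u = sqSum m u := by
  refine Finset.sum_congr rfl fun l hl => ?_
  rw [mem_words] at hl
  have hnil : l ≠ [] := by rintro rfl; simp at hl; omega
  have : (m : ℝ) ≠ 0 := by exact_mod_cast hm.ne'
  refine integral_congr_ae (Eventually.of_forall fun z => ?_)
  simp only [gnFun, if_neg hnil, hl]
  rw [mul_div_assoc, div_self this, mul_one, Real.rpow_two, sq_abs]

lemma integral_sq_mul_le (i j : ℕ) :
    ∃ C : ℝ, 0 ≤ C ∧ ∀ u v : smoothFun, HasCompactSupport (u : (Fin 2 → ℝ) → ℝ) →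
      HasCompactSupport (v : (Fin 2 → ℝ) → ℝ) →
      (∀ z, |(u : (Fin 2 → ℝ) → ℝ) z| ≤ 1) → (∀ z, |(v : (Fin 2 → ℝ) → ℝ) z| ≤ 1) →
      ∀ l l' : List (Fin 3), l.length = i → l'.length = j →
      ∫ z, ((wordOp l u : (Fin 2 → ℝ) → ℝ) z * (wordOp l' v : (Fin 2 → ℝ) → ℝ) z) ^ 2 ∂Gmeasure
        ≤ C * (sqSum (i + j) u + sqSum (i + j) v) := by
  have h_intgsq : ∀ (w : smoothFun), HasCompactSupport (w : (Fin 2 → ℝ) → ℝ) → ∀ l,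
      Integrable (fun z => (wordOp l w : (Fin 2 → ℝ) → ℝ) z ^ 2) Gmeasure := fun w hw l =>
    Continuous.integrable_of_hasCompactSupport ((smoothFun.continuous _).pow 2)
      ((hw.wordOp l).comp_left (g := fun x => x ^ 2) (by simp))
  have hsq : ∀ x : ℝ, |x| ≤ 1 → x ^ 2 ≤ 1 := fun x hx => by
    rw [← sq_abs]; exact pow_le_one₀ (abs_nonneg x) hx
  rcases Nat.eq_zero_or_pos i with rfl | hi
  · refine ⟨1, zero_le_one, fun u v hu hv hu1 hv1 l l' hl hl' => ?_⟩
    obtain rfl : l = [] := by simpa using hl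
    rw [one_mul, zero_add]
    have h := integral_sq_le_sqSum l' v
    rw [hl'] at h
    refine le_trans ?_ (h.trans (le_add_of_nonneg_left (sqSum_nonneg _ _)))
    refine integral_mono_of_nonneg (Eventually.of_forall fun z => by positivity)
      (h_intgsq v hv l') (Eventually.of_forall fun z => ?_)
    simp only [wordOp_nil, Module.End.one_apply, mul_pow]
    exact mul_le_of_le_one_left (sq_nonneg _) (hsq _ (hu1 z))
  rcases Nat.eq_zero_or_pos j with rfl | hj
  · refine ⟨1, zero_le_one, fun u v hu hv hu1 hv1 l l' hl hl' => ?_⟩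
    obtain rfl : l' = [] := by simpa using hl'
    rw [one_mul, add_zero]
    have h := integral_sq_le_sqSum l u
    rw [hl] at h
    refine le_trans ?_ (h.trans (le_add_of_nonneg_right (sqSum_nonneg _ _)))
    refine integral_mono_of_nonneg (Eventually.of_forall fun z => by positivity)
      (h_intgsq u hu l) (Eventually.of_forall fun z => ?_)
    simp only [wordOp_nil, Module.End.one_apply, mul_pow]
    exact mul_le_of_le_one_right (sq_nonneg _) (hsq _ (hv1 z))
  set m := i + j with hm
  have hm0 : 0 < m := by omega
  obtain ⟨C, hC, h⟩ := gnSum_le_gnSum_self (k := m) (n := i) (by omega)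
  obtain ⟨C', hC', h'⟩ := gnSum_le_gnSum_self (k := m) (n := j) (by omega)
  refine ⟨C + C', by positivity, fun u v hu hv hu1 hv1 l l' hl hl' => ?_⟩
  have hir : (0 : ℝ) < i := by exact_mod_cast hi
  have hjr : (0 : ℝ) < j := by exact_mod_cast hj
  have hmr : (m : ℝ) = i + j := by rw [hm]; push_cast; rfl
  have hmr0 : (0 : ℝ) < m := by rw [hmr]; positivity
  have hnil : l ≠ [] := by rintro rfl; simp at hl; omega
  have hnil' : l' ≠ [] := by rintro rfl; simp at hl'; omega
  have hpt : ∀ z, ((wordOp l u : (Fin 2 → ℝ) → ℝ) z * (wordOp l' v : (Fin 2 → ℝ) → ℝ) z) ^ 2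
      ≤ gnFun m l u z + gnFun m l' v z := by
    intro z
    have hroot : ∀ (x : ℝ) (n : ℝ), 0 < n → (|x| ^ (2 * (m : ℝ) / n)) ^ (n / m) = x ^ 2 := by
      intro x n hn
      rw [← Real.rpow_mul (abs_nonneg _), show 2 * (m : ℝ) / n * (n / m) = 2 by field_simp,
        Real.rpow_two, sq_abs]
    have hA := Real.geom_mean_le_arith_mean2_weighted (w₁ := (i : ℝ) / m) (w₂ := (j : ℝ) / m)
      (by positivity) (by positivity) (gnFun_nonneg m l u z) (gnFun_nonneg m l' v z)
      (by rw [← add_div, ← hmr, div_self hmr0.ne'])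
    have e1 : gnFun m l u z ^ ((i : ℝ) / m) = (wordOp l u : (Fin 2 → ℝ) → ℝ) z ^ 2 := by
      rw [gnFun, if_neg hnil, hl, hroot _ _ hir]
    have e2 : gnFun m l' v z ^ ((j : ℝ) / m) = (wordOp l' v : (Fin 2 → ℝ) → ℝ) z ^ 2 := by
      rw [gnFun, if_neg hnil', hl', hroot _ _ hjr]
    rw [e1, e2, ← mul_pow] at hA
    refine hA.trans (add_le_add ?_ ?_)
    · exact mul_le_of_le_one_left (gnFun_nonneg _ _ _ _)
        ((div_le_one hmr0).2 (by rw [hmr]; linarith))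
    · exact mul_le_of_le_one_left (gnFun_nonneg _ _ _ _)
        ((div_le_one hmr0).2 (by rw [hmr]; linarith))
  have i1 := integrable_gnFun hm0 l hu
  have i2 := integrable_gnFun hm0 l' hv
  have hle : ∫ z, ((wordOp l u : (Fin 2 → ℝ) → ℝ) z * (wordOp l' v : (Fin 2 → ℝ) → ℝ) z) ^ 2
      ∂Gmeasure ≤ ∫ z, gnFun m l u z ∂Gmeasure + ∫ z, gnFun m l' v z ∂Gmeasure := by
    rw [← integral_add i1 i2]
    exact integral_mono_of_nonneg (Eventually.of_forall fun z => by positivity) (i1.add i2)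
      (Eventually.of_forall hpt)
  have b1 := integral_gnFun_le_gnSum m l u
  have b2 := integral_gnFun_le_gnSum m l' v
  rw [hl] at b1
  rw [hl'] at b2
  have b3 := h u hu hu1
  have b4 := h' v hv hv1
  rw [gnSum_self hm0] at b3 b4
  have hu0 := sqSum_nonneg m u
  have hv0 := sqSum_nonneg m v
  nlinarith [mul_nonneg hC hv0, mul_nonneg hC' hu0]

lemma sqSum_smul (m : ℕ) (c : ℝ) (u : smoothFun) : sqSum m (c • u) = c ^ 2 * sqSum m u := by
  simp only [sqSum, Finset.mul_sum, ← integral_const_mul]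
  refine Finset.sum_congr rfl fun l _ => integral_congr_ae (Eventually.of_forall fun z => ?_)
  simp [mul_pow]

/-- The Moser estimate for compactly supported functions. -/
lemma integral_sq_mul_le_of_bound (i j : ℕ) :
    ∃ C : ℝ, 0 ≤ C ∧ ∀ u v : smoothFun, HasCompactSupport (u : (Fin 2 → ℝ) → ℝ) →
      HasCompactSupport (v : (Fin 2 → ℝ) → ℝ) → ∀ a b : ℝ, 0 < a → 0 < b →
      (∀ z, |(u : (Fin 2 → ℝ) → ℝ) z| ≤ a) → (∀ z, |(v : (Fin 2 → ℝ) → ℝ) z| ≤ b) →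
      ∀ l l' : List (Fin 3), l.length = i → l'.length = j →
      ∫ z, ((wordOp l u : (Fin 2 → ℝ) → ℝ) z * (wordOp l' v : (Fin 2 → ℝ) → ℝ) z) ^ 2 ∂Gmeasure
        ≤ C * (b ^ 2 * sqSum (i + j) u + a ^ 2 * sqSum (i + j) v) := by
  obtain ⟨C, hC, h⟩ := integral_sq_mul_le i j
  refine ⟨C, hC, fun u v hu hv a b ha hb hua hvb l l' hl hl' => ?_⟩
  have hbound : ∀ (w : smoothFun) (c : ℝ), 0 < c → (∀ z, |(w : (Fin 2 → ℝ) → ℝ) z| ≤ c) →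
      ∀ z, |((c⁻¹ • w : smoothFun) : (Fin 2 → ℝ) → ℝ) z| ≤ 1 := by
    intro w c hc hw z
    have : ((c⁻¹ • w : smoothFun) : (Fin 2 → ℝ) → ℝ) z = c⁻¹ * (w : (Fin 2 → ℝ) → ℝ) z := rfl
    rw [this, abs_mul, abs_of_pos (inv_pos.2 hc), inv_mul_le_iff₀ hc, mul_one]
    exact hw z
  have key := h (a⁻¹ • u) (b⁻¹ • v) (hu.mul_left (f := fun _ => a⁻¹))
    (hv.mul_left (f := fun _ => b⁻¹)) (hbound u a ha hua) (hbound v b hb hvb) l l' hl hl'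
  rw [sqSum_smul, sqSum_smul] at key
  have e : ∀ z, ((wordOp l (a⁻¹ • u) : (Fin 2 → ℝ) → ℝ) z
        * (wordOp l' (b⁻¹ • v) : (Fin 2 → ℝ) → ℝ) z) ^ 2
      = (a⁻¹ ^ 2 * b⁻¹ ^ 2)
        * ((wordOp l u : (Fin 2 → ℝ) → ℝ) z * (wordOp l' v : (Fin 2 → ℝ) → ℝ) z) ^ 2 := by
    intro z
    simp only [map_smul, Subalgebra.coe_smul, Pi.smul_apply, smul_eq_mul]
    ring
  simp_rw [e, integral_const_mul] at key
  have := mul_le_mul_of_nonneg_left key (by positivity : 0 ≤ a ^ 2 * b ^ 2)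
  field_simp at this ⊢
  linarith

lemma znorm_nonneg (z : Fin 2 → ℝ) : 0 ≤ znorm z := Real.sqrt_nonneg _

lemma continuous_znorm : Continuous znorm := by unfold znorm; fun_prop

lemma zjap_eq (z : Fin 2 → ℝ) : zjap z = √(1 + znorm z ^ 2) := by
  rw [znorm_sq]; rfl

lemma znorm_eq (z : Fin 2 → ℝ) : znorm z = √(normSqFun z) := rfl

lemma isCompact_znorm_le (R : ℝ) : IsCompact {z : Fin 2 → ℝ | znorm z ≤ R} := by
  refine (isCompact_closedBall (0 : Fin 2 → ℝ) R).of_isClosed_subset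
    (isClosed_le continuous_znorm continuous_const) fun z hz => ?_
  have hz : znorm z ≤ R := hz
  rw [mem_closedBall_zero_iff, pi_norm_le_iff_of_nonneg ((znorm_nonneg z).trans hz)]
  intro k
  refine le_trans ?_ hz
  rw [Real.norm_eq_abs, ← Real.sqrt_sq_eq_abs]
  refine Real.sqrt_le_sqrt ?_
  fin_cases k
  · exact le_add_of_nonneg_right (sq_nonneg _)
  · exact le_add_of_nonneg_left (sq_nonneg _)

/-- The radial derivative factors: `Γᵢ r = dirFun i`. -/
def dirFun (i : Fin 3) (z : Fin 2 → ℝ) : ℝ := ![z 0 / znorm z, z 1 / znorm z, 0] i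

lemma differentiableAt_znorm {z : Fin 2 → ℝ} (hz : 0 < znorm z) : DifferentiableAt ℝ znorm z := by
  have h : normSqFun z ≠ 0 := by rw [← znorm_sq]; positivity
  exact (contDiff_normSqFun.differentiable (by simp) z).sqrt h

lemma GammaOp_znorm {z : Fin 2 → ℝ} (hz : 0 < znorm z) (i : Fin 3) :
    GammaOp i znorm z = dirFun i z := by
  have h : normSqFun z ≠ 0 := by rw [← znorm_sq]; positivity
  have hpd : ∀ k, pd k znorm z = z k / znorm z := by
    intro k
    have : pd k znorm z = _ := pd_radial (z := z) k (Real.hasDerivAt_sqrt h)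
    rw [this, ← znorm_eq]
    have := hz.ne'
    field_simp
  have hsq : znorm z ^ 2 = z 0 ^ 2 + z 1 ^ 2 := znorm_sq z
  have hne := hz.ne'
  fin_cases i
  · simp [GammaOp, hpd, cmat, hne, dirFun]
    field_simp
    linear_combination z 0 * (znorm z * (Real.tanh (znorm z))⁻¹ - 1) * hsq
  · simp [GammaOp, hpd, cmat, hne, dirFun]
    field_simp
    rw [hsq]; ring
  · simp [GammaOp, hpd, dirFun]
    ring

lemma GammaOp_radial {g : ℝ → ℝ} {g' : ℝ} {z : Fin 2 → ℝ} (hz : 0 < znorm z)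
    (hg : HasDerivAt g g' (znorm z)) (i : Fin 3) :
    GammaOp i (fun w => g (znorm w)) z = g' * dirFun i z := by
  rw [GammaOp_comp i hg (differentiableAt_znorm hz), GammaOp_znorm hz]

lemma differentiableAt_radial {g : ℝ → ℝ} {g' : ℝ} {z : Fin 2 → ℝ} (hz : 0 < znorm z)
    (hg : HasDerivAt g g' (znorm z)) : DifferentiableAt ℝ (fun w => g (znorm w)) z :=
  hg.differentiableAt.comp z (differentiableAt_znorm hz)

lemma differentiable_coord (k : Fin 2) : Differentiable ℝ fun z : Fin 2 → ℝ => z k := by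
  fun_prop

lemma GammaOp_coord_div {z : Fin 2 → ℝ} (hz : 0 < znorm z) (i : Fin 3) (k : Fin 2) :
    GammaOp i (fun w => w k / znorm w) z
      = ![(Real.tanh (znorm z))⁻¹ * ((if k = 0 then 1 else 0) - z 0 / znorm z * (z k / znorm z)),
          (Real.tanh (znorm z))⁻¹ * ((if k = 1 then 1 else 0) - z 1 / znorm z * (z k / znorm z)),
          if k = 0 then -(z 1 / znorm z) else z 0 / znorm z] i := by
  have hinv := hasDerivAt_inv hz.ne'
  have hpd : ∀ j k, pd j (fun w : Fin 2 → ℝ => w k) z = if j = k then 1 else 0 := by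
    intro j k
    exact congrFun (congrArg Subtype.val (pdDer_coordFun j k)) z |>.trans (by split_ifs <;> rfl)
  simp_rw [div_eq_mul_inv]
  rw [GammaOp_mul i (differentiable_coord k z) (differentiableAt_radial hz hinv),
    GammaOp_radial hz hinv]
  have hne := hz.ne'
  have htanh : Real.tanh (znorm z) ≠ 0 := by
    rw [Real.tanh_eq_sinh_div_cosh]
    exact div_ne_zero (Real.sinh_pos_iff.2 hz).ne' (Real.cosh_pos _).ne'
  fin_cases i <;> fin_cases k <;> simp [GammaOp, hpd, cmat, hne, dirFun] <;> field_simp <;> ring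

/-- Families of functions generated by those with bounded `Γ`-derivatives on `|z| > 1`. -/
inductive Tame : (ℕ → (Fin 2 → ℝ) → ℝ) → Prop
  | const (c : ℕ → ℝ) (C : ℝ) (hc : ∀ n, |c n| ≤ C) : Tame fun n _ => c n
  | coord (k : Fin 2) : Tame fun _ z => z k / znorm z
  | coth : Tame fun _ z => (Real.tanh (znorm z))⁻¹
  | tanh : Tame fun _ z => Real.tanh (znorm z)
  | ratio : Tame fun _ z => znorm z / √(1 + znorm z ^ 2)
  | inv : Tame fun _ z => (√(1 + znorm z ^ 2))⁻¹
  | cutoff (g : ℝ → ℝ) (hg : ContDiff ℝ (⊤ : ℕ∞) g) (hc : HasCompactSupport g) :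
      Tame fun n z => g (√(1 + znorm z ^ 2) / (n + 1))
  | add {P Q : ℕ → (Fin 2 → ℝ) → ℝ} (hP : Tame P) (hQ : Tame Q) : Tame fun n z => P n z + Q n z
  | mul {P Q : ℕ → (Fin 2 → ℝ) → ℝ} (hP : Tame P) (hQ : Tame Q) : Tame fun n z => P n z * Q n z

lemma Tame.const' (c : ℝ) : Tame fun _ _ => c := Tame.const (fun _ => c) |c| fun _ => le_rfl

lemma Tame.dirFun (i : Fin 3) : Tame fun _ => _root_.dirFun i := by
  fin_cases i
  exacts [Tame.coord 0, Tame.coord 1, Tame.const' 0]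

lemma Tame.congr {P Q : ℕ → (Fin 2 → ℝ) → ℝ} (hP : Tame P) (h : ∀ n z, Q n z = P n z) :
    Tame Q := by
  rwa [show Q = P from funext fun n => funext fun z => h n z]

lemma hasDerivAt_tanh (x : ℝ) : HasDerivAt Real.tanh (1 - Real.tanh x ^ 2) x := by
  have h := (Real.hasDerivAt_sinh x).div (Real.hasDerivAt_cosh x) (Real.cosh_pos x).ne'
  have he : Real.tanh = Real.sinh / Real.cosh := funext Real.tanh_eq_sinh_div_cosh
  rw [he]
  refine h.congr_deriv ?_
  have := (Real.cosh_pos x).ne'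
  simp only [Pi.div_apply]
  field_simp

lemma tanh_pos {x : ℝ} (hx : 0 < x) : 0 < Real.tanh x := by
  rw [Real.tanh_eq_sinh_div_cosh]
  exact div_pos (Real.sinh_pos_iff.2 hx) (Real.cosh_pos x)

lemma tanh_mono : Monotone Real.tanh :=
  monotone_of_hasDerivAt_nonneg hasDerivAt_tanh fun x => by
    have := Real.tanh_sq_lt_one x
    simp only [Pi.zero_apply]
    linarith

lemma hasDerivAt_coth {x : ℝ} (hx : 0 < x) :
    HasDerivAt (fun x => (Real.tanh x)⁻¹) (1 - (Real.tanh x)⁻¹ * (Real.tanh x)⁻¹) x := by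
  have := (tanh_pos hx).ne'
  refine ((hasDerivAt_tanh x).inv this).congr_deriv ?_
  field_simp
  ring

lemma hasDerivAt_sqrt_one_add_sq (x : ℝ) :
    HasDerivAt (fun x : ℝ => √(1 + x ^ 2)) (x / √(1 + x ^ 2)) x := by
  have h : HasDerivAt (fun x : ℝ => 1 + x ^ 2) (2 * x) x := by
    simpa using (hasDerivAt_pow 2 x).const_add 1
  refine (h.sqrt (by positivity)).congr_deriv ?_
  field_simp

lemma hasDerivAt_ratio (x : ℝ) :
    HasDerivAt (fun x : ℝ => x / √(1 + x ^ 2))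
      ((√(1 + x ^ 2))⁻¹ * (1 + -1 * (x / √(1 + x ^ 2) * (x / √(1 + x ^ 2))))) x := by
  have hpos : 0 < √(1 + x ^ 2) := by positivity
  refine ((hasDerivAt_id x).div (hasDerivAt_sqrt_one_add_sq x) hpos.ne').congr_deriv ?_
  simp only [id]
  field_simp
  ring

lemma hasDerivAt_inv_sqrt (x : ℝ) :
    HasDerivAt (fun x : ℝ => (√(1 + x ^ 2))⁻¹)
      (-1 * (x / √(1 + x ^ 2) * ((√(1 + x ^ 2))⁻¹ * (√(1 + x ^ 2))⁻¹))) x := by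
  have hpos : 0 < √(1 + x ^ 2) := by positivity
  refine ((hasDerivAt_sqrt_one_add_sq x).inv hpos.ne').congr_deriv ?_
  field_simp

lemma hasDerivAt_cutoff {g : ℝ → ℝ} (hg : ContDiff ℝ (⊤ : ℕ∞) g) (n : ℕ) (x : ℝ) :
    HasDerivAt (fun x : ℝ => g (√(1 + x ^ 2) / (n + 1)))
      (((n : ℝ) + 1)⁻¹ * (deriv g (√(1 + x ^ 2) / (n + 1)) * (x / √(1 + x ^ 2)))) x := by
  have h := (hg.differentiable (by simp) (√(1 + x ^ 2) / (n + 1))).hasDerivAt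
  refine (h.comp x ((hasDerivAt_sqrt_one_add_sq x).div_const ((n : ℝ) + 1))).congr_deriv ?_
  field_simp

lemma Tame.exists_bound {P : ℕ → (Fin 2 → ℝ) → ℝ} (hP : Tame P) :
    ∃ C : ℝ, 0 ≤ C ∧ ∀ n z, 1 < znorm z → |P n z| ≤ C := by
  induction hP with
  | const c C hc => exact ⟨C, (abs_nonneg _).trans (hc 0), fun n z _ => hc n⟩
  | coord k =>
    refine ⟨1, zero_le_one, fun n z hz => ?_⟩
    rw [abs_div, abs_of_nonneg (znorm_nonneg z), div_le_one (by linarith),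
      ← Real.sqrt_sq_eq_abs]
    refine Real.sqrt_le_sqrt ?_
    fin_cases k
    · exact le_add_of_nonneg_right (sq_nonneg _)
    · exact le_add_of_nonneg_left (sq_nonneg _)
  | coth =>
    refine ⟨(Real.tanh 1)⁻¹, inv_nonneg.2 (tanh_pos one_pos).le, fun n z hz => ?_⟩
    rw [abs_of_pos (inv_pos.2 (tanh_pos (by linarith)))]
    exact inv_anti₀ (tanh_pos one_pos) (tanh_mono hz.le)
  | tanh => exact ⟨1, zero_le_one, fun n z _ => (Real.abs_tanh_lt_one _).le⟩
  | ratio =>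
    refine ⟨1, zero_le_one, fun n z hz => ?_⟩
    rw [abs_of_nonneg (div_nonneg (znorm_nonneg z) (Real.sqrt_nonneg _)),
      div_le_one (by positivity)]
    exact Real.le_sqrt_of_sq_le (by linarith)
  | inv =>
    refine ⟨1, zero_le_one, fun n z hz => ?_⟩
    rw [abs_of_nonneg (inv_nonneg.2 (Real.sqrt_nonneg _))]
    refine inv_le_one_of_one_le₀ (Real.one_le_sqrt.2 ?_)
    have := sq_nonneg (znorm z)
    linarith
  | cutoff g hg hc =>
    obtain ⟨C, hC⟩ := hc.exists_bound_of_continuous hg.continuous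
    exact ⟨C, (norm_nonneg _).trans (hC 0), fun n z _ => hC _⟩
  | add _ _ ihP ihQ =>
    obtain ⟨C, hC, h⟩ := ihP
    obtain ⟨C', hC', h'⟩ := ihQ
    exact ⟨C + C', add_nonneg hC hC', fun n z hz =>
      (abs_add_le _ _).trans (add_le_add (h n z hz) (h' n z hz))⟩
  | mul _ _ ihP ihQ =>
    obtain ⟨C, hC, h⟩ := ihP
    obtain ⟨C', hC', h'⟩ := ihQ
    refine ⟨C * C', mul_nonneg hC hC', fun n z hz => ?_⟩
    rw [abs_mul]
    exact mul_le_mul (h n z hz) (h' n z hz) (abs_nonneg _) hC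

lemma Tame.differentiableAt {P : ℕ → (Fin 2 → ℝ) → ℝ} (hP : Tame P) :
    ∀ n z, 1 < znorm z → DifferentiableAt ℝ (P n) z := by
  induction hP with
  | const c C hc => exact fun n z _ => differentiableAt_const _
  | coord k =>
    intro n z hz
    have hz0 : 0 < znorm z := by linarith
    simp_rw [div_eq_mul_inv]
    exact (differentiable_coord k z).mul (differentiableAt_radial hz0 (hasDerivAt_inv hz0.ne'))
  | coth => exact fun n z hz => differentiableAt_radial (by linarith) (hasDerivAt_coth (by linarith))
  | tanh => exact fun n z hz => differentiableAt_radial (by linarith) (hasDerivAt_tanh _)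
  | ratio => exact fun n z hz => differentiableAt_radial (by linarith) (hasDerivAt_ratio _)
  | inv => exact fun n z hz => differentiableAt_radial (by linarith) (hasDerivAt_inv_sqrt _)
  | cutoff g hg hc =>
    exact fun n z hz => differentiableAt_radial (by linarith) (hasDerivAt_cutoff hg n _)
  | add _ _ ihP ihQ => exact fun n z hz => (ihP n z hz).add (ihQ n z hz)
  | mul _ _ ihP ihQ => exact fun n z hz => (ihP n z hz).mul (ihQ n z hz)

lemma GammaOp_add (i : Fin 3) {F G : (Fin 2 → ℝ) → ℝ} {z : Fin 2 → ℝ}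
    (hF : DifferentiableAt ℝ F z) (hG : DifferentiableAt ℝ G z) :
    GammaOp i (fun w => F w + G w) z = GammaOp i F z + GammaOp i G z := by
  have h : ∀ k, pd k (fun w => F w + G w) z = pd k F z + pd k G z := by
    intro k; simp [pd, fderiv_fun_add hF hG]
  unfold GammaOp
  split_ifs <;> simp only [Fin.sum_univ_two, h] <;> ring

lemma GammaOp_const (i : Fin 3) (c : ℝ) (z : Fin 2 → ℝ) : GammaOp i (fun _ => c) z = 0 := by
  simp [GammaOp, pd]

lemma Tame.exists_GammaOp {P : ℕ → (Fin 2 → ℝ) → ℝ} (hP : Tame P) (i : Fin 3) :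
    ∃ Q, Tame Q ∧ ∀ n z, 1 < znorm z → GammaOp i (P n) z = Q n z := by
  have hsub : ∀ {P Q : ℕ → (Fin 2 → ℝ) → ℝ}, Tame P → Tame Q →
      Tame fun n z => P n z - Q n z := fun hP hQ =>
    (hP.add ((Tame.const' (-1)).mul hQ)).congr fun n z => by ring
  induction hP with
  | const c C hc => exact ⟨_, Tame.const' 0, fun n z _ => GammaOp_const i _ z⟩
  | coord k =>
    refine ⟨_, ?_, fun n z hz => GammaOp_coord_div (by linarith) i k⟩
    fin_cases i
    · exact Tame.coth.mul (hsub (Tame.const' _) ((Tame.coord 0).mul (Tame.coord k)))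
    · exact Tame.coth.mul (hsub (Tame.const' _) ((Tame.coord 1).mul (Tame.coord k)))
    · fin_cases k
      · exact ((Tame.const' (-1)).mul (Tame.coord 1)).congr fun n z => by simp
      · exact Tame.coord 0
  | coth =>
    exact ⟨_, (hsub (Tame.const' 1) (Tame.coth.mul Tame.coth)).mul (Tame.dirFun i), fun n z hz =>
      GammaOp_radial (by linarith) (hasDerivAt_coth (by linarith)) i⟩
  | tanh =>
    refine ⟨_, (hsub (Tame.const' 1) (Tame.tanh.mul Tame.tanh)).mul (Tame.dirFun i), fun n z hz => ?_⟩
    rw [GammaOp_radial (by linarith) (hasDerivAt_tanh _) i, sq]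
  | ratio =>
    exact ⟨_, (Tame.inv.mul ((Tame.const' 1).add ((Tame.const' (-1)).mul
      (Tame.ratio.mul Tame.ratio)))).mul (Tame.dirFun i), fun n z hz =>
      GammaOp_radial (by linarith) (hasDerivAt_ratio _) i⟩
  | inv =>
    exact ⟨_, ((Tame.const' (-1)).mul (Tame.ratio.mul (Tame.inv.mul Tame.inv))).mul
      (Tame.dirFun i), fun n z hz => GammaOp_radial (by linarith) (hasDerivAt_inv_sqrt _) i⟩
  | cutoff g hg hc =>
    have hc' : Tame fun (n : ℕ) (_ : Fin 2 → ℝ) => ((n : ℝ) + 1)⁻¹ := by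
      refine Tame.const (fun n : ℕ => ((n : ℝ) + 1)⁻¹) 1 fun n => ?_
      rw [abs_of_pos (by positivity)]
      exact inv_le_one_of_one_le₀ (by linarith [(Nat.cast_nonneg n : (0 : ℝ) ≤ n)])
    have hg' : ContDiff ℝ (⊤ : ℕ∞) (deriv g) := (contDiff_infty_iff_deriv.1 hg).2
    exact ⟨_, (hc'.mul ((Tame.cutoff _ hg' hc.deriv).mul Tame.ratio)).mul (Tame.dirFun i),
      fun n z hz => GammaOp_radial (by linarith) (hasDerivAt_cutoff hg n _) i⟩
  | add hP hQ ihP ihQ =>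
    obtain ⟨A, hA, h⟩ := ihP
    obtain ⟨B, hB, h'⟩ := ihQ
    refine ⟨_, hA.add hB, fun n z hz => ?_⟩
    rw [GammaOp_add i (hP.differentiableAt n z hz) (hQ.differentiableAt n z hz), h n z hz,
      h' n z hz]
  | @mul P Q hP hQ ihP ihQ =>
    obtain ⟨A, hA, h⟩ := ihP
    obtain ⟨B, hB, h'⟩ := ihQ
    refine ⟨_, (hP.mul hB).add (hA.mul hQ), fun n z hz => ?_⟩
    rw [GammaOp_mul i (hP.differentiableAt n z hz) (hQ.differentiableAt n z hz), h n z hz,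
      h' n z hz]

/-- The radial profile `e^{β log cosh r - α ⟨r⟩}`. -/
def weightProfile (α β r : ℝ) : ℝ :=
  Real.exp (β * Real.log (Real.cosh r) - α * √(1 + r ^ 2))

lemma weightProfile_pos (α β r : ℝ) : 0 < weightProfile α β r := Real.exp_pos _

lemma hasDerivAt_weightProfile (α β r : ℝ) :
    HasDerivAt (weightProfile α β)
      (weightProfile α β r * (β * Real.tanh r + -α * (r / √(1 + r ^ 2)))) r := by
  have h1 := ((Real.hasDerivAt_cosh r).log (Real.cosh_pos r).ne').const_mul β
  have h2 := (hasDerivAt_sqrt_one_add_sq r).const_mul α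
  refine (h1.sub h2).exp.congr_deriv ?_
  rw [Real.tanh_eq_sinh_div_cosh, weightProfile]
  simp only [Pi.sub_apply]
  ring

lemma contDiff_cosh_znorm : ContDiff ℝ (⊤ : ℕ∞) fun z => Real.cosh (znorm z) := by
  have h : (fun z => Real.cosh (znorm z)) = fun z =>
      sinhcSq (normSqFun z) + 2 * normSqFun z * deriv sinhcSq (normSqFun z) := by
    funext z
    rw [← sinhcSq_add_deriv, znorm_sq]
  rw [h]
  exact (contDiff_sinhcSq.comp contDiff_normSqFun).add
    ((contDiff_const.mul contDiff_normSqFun).mul (contDiff_deriv_sinhcSq.comp contDiff_normSqFun))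

lemma contDiff_sqrt_one_add_znorm_sq : ContDiff ℝ (⊤ : ℕ∞) fun z => √(1 + znorm z ^ 2) := by
  simp_rw [znorm_sq]
  refine (contDiff_const.add contDiff_normSqFun).sqrt fun z => ?_
  have := normSqFun_nonneg z
  positivity

/-- The weight `e^{β log cosh |z| - α ⟨z⟩}`. -/
def weightFun (α β : ℝ) : smoothFun :=
  ⟨fun z => weightProfile α β (znorm z),
    ((contDiff_const.mul (contDiff_cosh_znorm.log fun _ => (Real.cosh_pos _).ne')).sub
      (contDiff_const.mul contDiff_sqrt_one_add_znorm_sq)).exp⟩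

lemma weightFun_apply (α β : ℝ) (z : Fin 2 → ℝ) :
    (weightFun α β : (Fin 2 → ℝ) → ℝ) z = weightProfile α β (znorm z) := rfl

lemma GammaOp_congr_of_isOpen (i : Fin 3) {F G : (Fin 2 → ℝ) → ℝ} {U : Set (Fin 2 → ℝ)}
    (hU : IsOpen U) (h : ∀ z ∈ U, F z = G z) : ∀ z ∈ U, GammaOp i F z = GammaOp i G z := by
  intro z hz
  have he : F =ᶠ[nhds z] G := Filter.eventuallyEq_of_mem (hU.mem_nhds hz) h
  have hpd : ∀ k, pd k F z = pd k G z := fun k => by simp only [pd, he.fderiv_eq]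
  simp only [GammaOp, hpd]

lemma wordOp_cons_apply (i : Fin 3) (l : List (Fin 3)) (F : smoothFun) :
    (wordOp (i :: l) F : (Fin 2 → ℝ) → ℝ) = GammaOp i (wordOp l F : (Fin 2 → ℝ) → ℝ) := by
  rw [wordOp_cons, ← gammaDer_apply]; rfl

lemma wordOp_congr_of_isOpen (l : List (Fin 3)) {F G : smoothFun} {U : Set (Fin 2 → ℝ)}
    (hU : IsOpen U) (h : ∀ z ∈ U, (F : (Fin 2 → ℝ) → ℝ) z = (G : (Fin 2 → ℝ) → ℝ) z) :
    ∀ z ∈ U, (wordOp l F : (Fin 2 → ℝ) → ℝ) z = (wordOp l G : (Fin 2 → ℝ) → ℝ) z := by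
  induction l with
  | nil => exact h
  | cons i l ih =>
    rw [wordOp_cons_apply, wordOp_cons_apply]
    exact GammaOp_congr_of_isOpen i hU ih

lemma isOpen_one_lt_znorm : IsOpen {z : Fin 2 → ℝ | 1 < znorm z} :=
  isOpen_lt continuous_const continuous_znorm

lemma exists_tame_wordOp (α β : ℝ) {F : ℕ → smoothFun} {P : ℕ → (Fin 2 → ℝ) → ℝ} (hP : Tame P)
    (hF : ∀ n z, 1 < znorm z → (F n : (Fin 2 → ℝ) → ℝ) z = weightProfile α β (znorm z) * P n z)
    (l : List (Fin 3)) :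
    ∃ Q, Tame Q ∧ ∀ n z, 1 < znorm z →
      (wordOp l (F n) : (Fin 2 → ℝ) → ℝ) z = weightProfile α β (znorm z) * Q n z := by
  induction l with
  | nil => exact ⟨P, hP, hF⟩
  | cons i l ih =>
    obtain ⟨Q, hQ, h⟩ := ih
    obtain ⟨R, hR, h'⟩ := hQ.exists_GammaOp i
    refine ⟨_, hR.add ((((Tame.const' β).mul Tame.tanh).add
      ((Tame.const' (-α)).mul Tame.ratio)).mul (Tame.dirFun i) |>.mul hQ), fun n z hz => ?_⟩
    have hz0 : 0 < znorm z := by linarith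
    rw [wordOp_cons_apply, GammaOp_congr_of_isOpen i isOpen_one_lt_znorm (fun w hw => h n w hw) z hz,
      GammaOp_mul i (differentiableAt_radial hz0 (hasDerivAt_weightProfile α β _))
        (hQ.differentiableAt n z hz), h' n z hz,
      GammaOp_radial hz0 (hasDerivAt_weightProfile α β _)]
    ring

lemma exists_bound_wordOp {α β : ℝ} (hle : ∀ r, 0 ≤ r → weightProfile α β r ≤ 1)
    {F : ℕ → smoothFun} {F₀ : smoothFun} {P : ℕ → (Fin 2 → ℝ) → ℝ} (hP : Tame P)
    (hF : ∀ n z, 1 < znorm z → (F n : (Fin 2 → ℝ) → ℝ) z = weightProfile α β (znorm z) * P n z)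
    (hF₀ : ∀ n z, znorm z < 2 → (F n : (Fin 2 → ℝ) → ℝ) z = (F₀ : (Fin 2 → ℝ) → ℝ) z)
    (l : List (Fin 3)) :
    ∃ C : ℝ, 0 ≤ C ∧ ∀ n z, |(wordOp l (F n) : (Fin 2 → ℝ) → ℝ) z| ≤ C := by
  obtain ⟨Q, hQ, h⟩ := exists_tame_wordOp α β hP hF l
  obtain ⟨C, hC, hb⟩ := hQ.exists_bound
  obtain ⟨C', hC'⟩ := (isCompact_znorm_le 1).exists_bound_of_continuousOn
    (smoothFun.continuous (wordOp l F₀)).continuousOn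
  refine ⟨max C C', le_max_of_le_left hC, fun n z => ?_⟩
  rcases lt_or_ge 1 (znorm z) with hz | hz
  · rw [h n z hz, abs_mul]
    refine le_trans ?_ (le_max_left _ _)
    have h1 : |weightProfile α β (znorm z)| ≤ 1 := by
      rw [abs_of_pos (weightProfile_pos _ _ _)]; exact hle _ (znorm_nonneg z)
    exact (mul_le_of_le_one_left (abs_nonneg _) h1).trans (hb n z hz)
  · have : z ∈ {z : Fin 2 → ℝ | znorm z < 2} := by
      simp only [Set.mem_ofPred_eq]; linarith
    rw [wordOp_congr_of_isOpen l (isOpen_lt continuous_znorm continuous_const)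
      (fun w hw => hF₀ n w hw) z this]
    exact (hC' z hz).trans (le_max_right _ _)

lemma weightProfile_le_one {κ : ℝ} (hκ : 4 ≤ κ) {r : ℝ} (hr : 0 ≤ r) :
    weightProfile κ 4 r ≤ 1 := by
  rw [weightProfile, Real.exp_le_one_iff]
  have h1 : Real.log (Real.cosh r) ≤ r := by
    rw [Real.log_le_iff_le_exp (Real.cosh_pos r), Real.cosh_eq]
    have : Real.exp (-r) ≤ Real.exp r := Real.exp_le_exp.2 (by linarith)
    linarith
  have h2 : r ≤ √(1 + r ^ 2) := Real.le_sqrt_of_sq_le (by linarith)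
  nlinarith [Real.sqrt_nonneg (1 + r ^ 2)]

lemma weightProfile_le (r : ℝ) : weightProfile 0 (-2) r ≤ 4 * Real.exp (-(2 * r)) := by
  have h : Real.exp r / 2 ≤ Real.cosh r := by
    rw [Real.cosh_eq]
    have := Real.exp_pos (-r)
    linarith
  have h1 : r - Real.log 2 ≤ Real.log (Real.cosh r) := by
    rw [Real.le_log_iff_exp_le (Real.cosh_pos r), Real.exp_sub, Real.exp_log (by norm_num)]
    exact h
  have h4 : (4 : ℝ) = Real.exp (2 * Real.log 2) := by
    rw [mul_comm, Real.exp_mul, Real.exp_log (by norm_num)]; norm_num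
  rw [weightProfile, h4, ← Real.exp_add, Real.exp_le_exp]
  linarith

lemma weightProfile_le_one' (r : ℝ) : weightProfile 0 (-2) r ≤ 1 := by
  rw [weightProfile, Real.exp_le_one_iff]
  have := Real.log_nonneg (Real.one_le_cosh r)
  linarith

lemma exists_bound_wordOp_weightFun {κ : ℝ} (hκ : 4 ≤ κ) (l : List (Fin 3)) :
    ∃ C : ℝ, 0 ≤ C ∧ ∀ z, |(wordOp l (weightFun κ 4) : (Fin 2 → ℝ) → ℝ) z| ≤ C := by
  obtain ⟨C, hC, h⟩ := exists_bound_wordOp (α := κ) (β := 4) (fun r hr => weightProfile_le_one hκ hr)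
    (F := fun _ => weightFun κ 4) (F₀ := weightFun κ 4) (Tame.const' 1)
    (fun n z _ => by rw [mul_one, weightFun_apply]) (fun n z _ => rfl) l
  exact ⟨C, hC, fun z => h 0 z⟩

/-- A smooth bump function on the line, equal to `1` on `[-3, 3]`. -/
def bump : ContDiffBump (0 : ℝ) := ⟨3, 4, by norm_num, by norm_num⟩

/-- The truncated weight `χ_n cosh⁻²`, where `χ_n` is a cutoff at scale `n`. -/
def cutWeight (n : ℕ) : smoothFun :=
  ⟨fun z => bump (√(1 + znorm z ^ 2) / (n + 1)) * weightProfile 0 (-2) (znorm z),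
    (bump.contDiff.comp (contDiff_sqrt_one_add_znorm_sq.div_const _)).mul
      (smoothFun.contDiff (weightFun 0 (-2)))⟩

lemma cutWeight_apply (n : ℕ) (z : Fin 2 → ℝ) : (cutWeight n : (Fin 2 → ℝ) → ℝ) z
    = bump (√(1 + znorm z ^ 2) / (n + 1)) * weightProfile 0 (-2) (znorm z) := rfl

lemma cutWeight_eq {n : ℕ} {z : Fin 2 → ℝ} (h : √(1 + znorm z ^ 2) ≤ 3 * (n + 1)) :
    (cutWeight n : (Fin 2 → ℝ) → ℝ) z = (weightFun 0 (-2) : (Fin 2 → ℝ) → ℝ) z := by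
  have hn : (0 : ℝ) < n + 1 := by positivity
  rw [cutWeight_apply, bump.one_of_mem_closedBall, one_mul, weightFun_apply]
  rw [mem_closedBall_zero_iff, Real.norm_eq_abs, abs_of_nonneg (by positivity)]
  exact (div_le_iff₀ hn).2 h

lemma exists_bound_wordOp_cutWeight (l : List (Fin 3)) :
    ∃ C : ℝ, 0 ≤ C ∧ ∀ n z, |(wordOp l (cutWeight n) : (Fin 2 → ℝ) → ℝ) z| ≤ C := by
  refine exists_bound_wordOp (α := 0) (β := -2) (fun r _ => weightProfile_le_one' r)
    (F₀ := weightFun 0 (-2)) (Tame.cutoff bump bump.contDiff bump.hasCompactSupport)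
    (fun n z _ => by rw [cutWeight_apply, mul_comm]) (fun n z hz => cutWeight_eq ?_) l
  rw [Real.sqrt_le_left (by positivity)]
  have hn : (1 : ℝ) ≤ (n : ℝ) + 1 := by linarith [(Nat.cast_nonneg n : (0 : ℝ) ≤ n)]
  have := znorm_nonneg z
  nlinarith

lemma hasCompactSupport_cutWeight (n : ℕ) :
    HasCompactSupport (cutWeight n : (Fin 2 → ℝ) → ℝ) := by
  refine HasCompactSupport.intro (isCompact_znorm_le (4 * (n + 1))) fun z hz => ?_
  have hz : 4 * ((n : ℝ) + 1) < znorm z := not_le.1 hz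
  have hn : (0 : ℝ) < n + 1 := by positivity
  rw [cutWeight_apply, bump.zero_of_le_dist, zero_mul]
  rw [dist_zero_right, Real.norm_eq_abs, abs_of_nonneg (by positivity), le_div_iff₀ hn]
  exact hz.le.trans (Real.le_sqrt_of_sq_le (by linarith))

lemma abs_cutWeight_le (n : ℕ) (z : Fin 2 → ℝ) :
    |(cutWeight n : (Fin 2 → ℝ) → ℝ) z| ≤ 4 * Real.exp (-(2 * znorm z)) := by
  rw [cutWeight_apply, abs_mul, abs_of_nonneg bump.nonneg,
    abs_of_pos (weightProfile_pos _ _ _)]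
  exact (mul_le_of_le_one_left (weightProfile_pos _ _ _).le bump.le_one).trans (weightProfile_le _)

/-- The sets on which the truncated weights agree with `cosh⁻²`. -/
def cutSet (n : ℕ) : Set (Fin 2 → ℝ) := {z | √(1 + znorm z ^ 2) < 3 * (n + 1)}

lemma isOpen_cutSet (n : ℕ) : IsOpen (cutSet n) :=
  isOpen_lt contDiff_sqrt_one_add_znorm_sq.continuous continuous_const

lemma eventually_mem_cutSet (z : Fin 2 → ℝ) : ∀ᶠ n : ℕ in atTop, z ∈ cutSet n := by
  filter_upwards [eventually_ge_atTop ⌈√(1 + znorm z ^ 2)⌉₊] with n hn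
  have h1 : √(1 + znorm z ^ 2) ≤ n := (Nat.le_ceil _).trans (by exact_mod_cast hn)
  have h2 : (0 : ℝ) ≤ n := Nat.cast_nonneg n
  change √(1 + znorm z ^ 2) < 3 * (n + 1)
  linarith

lemma eLpNorm_add_le_of_le {F G : smoothFun} {B : ℝ≥0∞} {C D : ℝ≥0}
    (hF : eLpNorm (F : (Fin 2 → ℝ) → ℝ) 2 Gmeasure ≤ C * B)
    (hG : eLpNorm (G : (Fin 2 → ℝ) → ℝ) 2 Gmeasure ≤ D * B) :
    eLpNorm ((F + G : smoothFun) : (Fin 2 → ℝ) → ℝ) 2 Gmeasure ≤ (C + D : ℝ≥0) * B := by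
  rw [Subalgebra.coe_add, ENNReal.coe_add, add_mul]
  exact (eLpNorm_add_le (smoothFun.continuous F).aestronglyMeasurable
    (smoothFun.continuous G).aestronglyMeasurable one_le_two).trans (add_le_add hF hG)

/-- A family of products satisfies an `L²` bound after applying `Γ^l` as soon as all the terms
in the Leibniz formula do. -/
lemma exists_bound_wordOp_mul {X : Type*} {S : Set X} {B : X → ℝ≥0∞} {u v : X → smoothFun}
    (l : List (Fin 3)) : ∀ m₁ m₂ : List (Fin 3),
    (∀ l₁ l₂ : List (Fin 3), l₁.length + l₂.length = l.length + m₁.length + m₂.length →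
      ∃ C : ℝ≥0, ∀ x ∈ S, eLpNorm ((wordOp l₁ (u x) * wordOp l₂ (v x) : smoothFun) :
        (Fin 2 → ℝ) → ℝ) 2 Gmeasure ≤ C * B x) →
    ∃ C : ℝ≥0, ∀ x ∈ S, eLpNorm (wordOp l (wordOp m₁ (u x) * wordOp m₂ (v x)) :
        (Fin 2 → ℝ) → ℝ) 2 Gmeasure ≤ C * B x := by
  induction l using List.reverseRecOn with
  | nil => intro m₁ m₂ h; exact h m₁ m₂ (by simp)
  | append_singleton l i ih =>
    intro m₁ m₂ h
    simp only [List.length_append, List.length_singleton] at h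
    obtain ⟨C₁, h₁⟩ := ih (i :: m₁) m₂ fun l₁ l₂ hl => h l₁ l₂ (by simp at hl; omega)
    obtain ⟨C₂, h₂⟩ := ih m₁ (i :: m₂) fun l₁ l₂ hl => h l₁ l₂ (by simp at hl; omega)
    refine ⟨C₂ + C₁, fun x hx => ?_⟩
    have : wordOp (l ++ [i]) (wordOp m₁ (u x) * wordOp m₂ (v x))
        = wordOp l (wordOp m₁ (u x) * wordOp (i :: m₂) (v x))
          + wordOp l (wordOp (i :: m₁) (u x) * wordOp m₂ (v x)) := by
      simp only [wordOp_append, wordOp_cons, wordOp_nil, mul_one, Module.End.mul_apply,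
        gammaEnd_apply, Derivation.leibniz, smul_eq_mul, map_add]
      rw [mul_comm (wordOp m₂ (v x))]
    rw [this]
    exact eLpNorm_add_le_of_le (h₂ x hx) (h₁ x hx)

lemma exists_bound_wordOp_mul_of_bounded {X : Type*} {S : Set X} {B : X → ℝ≥0∞}
    {u v : X → smoothFun} (l : List (Fin 3))
    (hu : ∀ l' : List (Fin 3), ∃ C : ℝ, 0 ≤ C ∧ ∀ x z, |(wordOp l' (u x) : (Fin 2 → ℝ) → ℝ) z| ≤ C)
    (hv : ∀ l' : List (Fin 3), l'.length ≤ l.length → ∃ C : ℝ≥0, ∀ x ∈ S,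
      eLpNorm (wordOp l' (v x) : (Fin 2 → ℝ) → ℝ) 2 Gmeasure ≤ C * B x) :
    ∃ C : ℝ≥0, ∀ x ∈ S, eLpNorm (wordOp l (u x * v x) : (Fin 2 → ℝ) → ℝ) 2 Gmeasure ≤ C * B x := by
  refine exists_bound_wordOp_mul l [] [] fun l₁ l₂ hl => ?_
  obtain ⟨C, hC0, hC⟩ := hu l₁
  obtain ⟨D, hD⟩ := hv l₂ (by simp at hl; omega)
  refine ⟨C.toNNReal * D, fun x hx => ?_⟩
  refine (eLpNorm_le_nnreal_smul_eLpNorm_of_ae_le_mul (c := C.toNNReal)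
    (g := (wordOp l₂ (v x) : (Fin 2 → ℝ) → ℝ)) (ae_of_all _ fun z => ?_) 2).trans ?_
  · rw [Subalgebra.coe_mul, Pi.mul_apply, nnnorm_mul]
    refine mul_le_mul_left ?_ _
    rw [← NNReal.coe_le_coe, Real.coe_toNNReal _ hC0]
    exact hC x z
  · rw [ENNReal.smul_def, smul_eq_mul, ENNReal.coe_mul, mul_assoc]
    gcongr
    exact hD x hx

lemma exists_bound_wordOp_cutWeight_mul {s : ℕ} (l : List (Fin 3)) (hl : l.length ≤ s) :
    ∃ C : ℝ≥0, ∀ (n : ℕ) (F : smoothFun),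
      eLpNorm (wordOp l (cutWeight n * F) : (Fin 2 → ℝ) → ℝ) 2 Gmeasure
        ≤ C * sNormE s (F : (Fin 2 → ℝ) → ℝ) := by
  obtain ⟨C, hC⟩ := exists_bound_wordOp_mul_of_bounded (X := ℕ × smoothFun) (S := Set.univ)
    (B := fun x => sNormE s (x.2 : (Fin 2 → ℝ) → ℝ)) (u := fun x => cutWeight x.1)
    (v := fun x => x.2) l
    (fun l' => by
      obtain ⟨C, hC0, hC⟩ := exists_bound_wordOp_cutWeight l'
      exact ⟨C, hC0, fun x z => hC x.1 z⟩)
    (fun l' hl' => by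
      obtain ⟨C, hC⟩ := eLpNorm_wordOp_le_sNormE s l' (hl'.trans hl)
      exact ⟨C, fun x _ => hC x.2⟩)
  exact ⟨C, fun n F => hC (n, F) (Set.mem_univ _)⟩

lemma sq_eLpNorm_two {F : smoothFun} (hF : HasCompactSupport (F : (Fin 2 → ℝ) → ℝ)) :
    eLpNorm (F : (Fin 2 → ℝ) → ℝ) 2 Gmeasure ^ 2
      = ENNReal.ofReal (∫ z, (F : (Fin 2 → ℝ) → ℝ) z ^ 2 ∂Gmeasure) := by
  rw [((smoothFun.continuous F).memLp_of_hasCompactSupport hF).eLpNorm_eq_integral_rpow_norm two_ne_zero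
    ENNReal.ofNat_ne_top, ← ENNReal.ofReal_pow (by positivity), ENNReal.toReal_ofNat,
    ← Real.rpow_natCast, ← Real.rpow_mul (by positivity)]
  norm_num

lemma ofReal_sqSum (m : ℕ) {u : smoothFun} (hu : HasCompactSupport (u : (Fin 2 → ℝ) → ℝ)) :
    ENNReal.ofReal (sqSum m u)
      = ∑ l ∈ words m, eLpNorm (wordOp l u : (Fin 2 → ℝ) → ℝ) 2 Gmeasure ^ 2 := by
  rw [sqSum, ENNReal.ofReal_sum_of_nonneg fun l _ => integral_nonneg fun z => sq_nonneg _]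
  exact Finset.sum_congr rfl fun l _ => (sq_eLpNorm_two (HasCompactSupport.wordOp hu l)).symm

lemma hasCompactSupport_cutWeight_mul (n : ℕ) (F : smoothFun) :
    HasCompactSupport ((cutWeight n * F : smoothFun) : (Fin 2 → ℝ) → ℝ) := by
  rw [Subalgebra.coe_mul]
  exact (hasCompactSupport_cutWeight n).mul_right

lemma exists_bound_sqSum_cutWeight_mul {s m : ℕ} (hm : m ≤ s) :
    ∃ C : ℝ≥0, ∀ (n : ℕ) (F : smoothFun),
      ENNReal.ofReal (sqSum m (cutWeight n * F)) ≤ C * sNormE s (F : (Fin 2 → ℝ) → ℝ) ^ 2 := by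
  have h : ∀ l : List (Fin 3), ∃ C : ℝ≥0, l ∈ words m → ∀ (n : ℕ) (F : smoothFun),
      eLpNorm (wordOp l (cutWeight n * F) : (Fin 2 → ℝ) → ℝ) 2 Gmeasure
        ≤ C * sNormE s (F : (Fin 2 → ℝ) → ℝ) := fun l => by
    by_cases hl : l ∈ words m
    · obtain ⟨C, hC⟩ := exists_bound_wordOp_cutWeight_mul l ((mem_words.1 hl).le.trans hm)
      exact ⟨C, fun _ => hC⟩
    · exact ⟨0, fun h => absurd h hl⟩
  choose C hC using h
  refine ⟨∑ l ∈ words m, C l ^ 2, fun n F => ?_⟩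
  rw [ofReal_sqSum m (hasCompactSupport_cutWeight_mul n F), ENNReal.ofNNReal_finsetSum,
    Finset.sum_mul]
  refine Finset.sum_le_sum fun l hl => ?_
  rw [ENNReal.coe_pow, ← mul_pow]
  exact pow_le_pow_left' (hC l hl n F) 2

/-- Quadruples `(φ, ψ, a, b)` of functions and positive numbers with `|φ| ≤ a e^{2|z|}` and
`|ψ| ≤ b e^{2|z|}`. -/
def growthSet : Set (smoothFun × smoothFun × ℝ × ℝ) :=
  {x | 0 < x.2.2.1 ∧ 0 < x.2.2.2
    ∧ (∀ z, Real.exp (-(2 * znorm z)) * |(x.1 : (Fin 2 → ℝ) → ℝ) z| ≤ x.2.2.1)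
    ∧ ∀ z, Real.exp (-(2 * znorm z)) * |(x.2.1 : (Fin 2 → ℝ) → ℝ) z| ≤ x.2.2.2}

/-- The right-hand side `a ‖ψ‖_{(s)} + ‖φ‖_{(s)} b` of the bilinear estimate. -/
def growthBound (s : ℕ) (x : smoothFun × smoothFun × ℝ × ℝ) : ℝ≥0∞ :=
  ENNReal.ofReal x.2.2.1 * sNormE s (x.2.1 : (Fin 2 → ℝ) → ℝ)
    + sNormE s (x.1 : (Fin 2 → ℝ) → ℝ) * ENNReal.ofReal x.2.2.2

lemma abs_cutWeight_mul_le (n : ℕ) {F : smoothFun} {a : ℝ}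
    (h : ∀ z, Real.exp (-(2 * znorm z)) * |(F : (Fin 2 → ℝ) → ℝ) z| ≤ a) (z : Fin 2 → ℝ) :
    |((cutWeight n * F : smoothFun) : (Fin 2 → ℝ) → ℝ) z| ≤ 4 * a := by
  rw [Subalgebra.coe_mul, Pi.mul_apply, abs_mul]
  calc _ ≤ 4 * Real.exp (-(2 * znorm z)) * |(F : (Fin 2 → ℝ) → ℝ) z| := by
        gcongr
        exact abs_cutWeight_le n z
    _ ≤ 4 * a := by rw [mul_assoc]; gcongr; exact h z

lemma exists_bound_cutWeight_mul_mul {s : ℕ} (l₁ l₂ : List (Fin 3))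
    (hl : l₁.length + l₂.length ≤ s) :
    ∃ C : ℝ≥0, ∀ (n : ℕ), ∀ x ∈ growthSet,
      eLpNorm ((wordOp l₁ (cutWeight n * x.1) * wordOp l₂ (cutWeight n * x.2.1) : smoothFun) :
        (Fin 2 → ℝ) → ℝ) 2 Gmeasure ≤ C * growthBound s x := by
  obtain ⟨C, hC0, hC⟩ := integral_sq_mul_le_of_bound l₁.length l₂.length
  obtain ⟨K, hK⟩ := exists_bound_sqSum_cutWeight_mul hl
  refine ⟨NNReal.sqrt (C.toNNReal * (16 * K)), fun n x hx => ?_⟩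
  obtain ⟨φ, ψ, a, b⟩ := x
  obtain ⟨ha, hb, hφ, hψ⟩ := hx
  simp only at ha hb hφ hψ
  have hm := hC _ _ (hasCompactSupport_cutWeight_mul n φ) (hasCompactSupport_cutWeight_mul n ψ)
    (4 * a) (4 * b) (by positivity) (by positivity) (abs_cutWeight_mul_le n hφ)
    (abs_cutWeight_mul_le n hψ) l₁ l₂ rfl rfl
  have hsup : HasCompactSupport ((wordOp l₁ (cutWeight n * φ) * wordOp l₂ (cutWeight n * ψ) :
      smoothFun) : (Fin 2 → ℝ) → ℝ) := by
    rw [Subalgebra.coe_mul]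
    exact (HasCompactSupport.wordOp (hasCompactSupport_cutWeight_mul n φ) l₁).mul_right
  refine (ENNReal.pow_le_pow_left_iff two_ne_zero).1 ?_
  rw [sq_eLpNorm_two hsup]
  have hφ' := hK n φ
  have hψ' := hK n ψ
  set U := sqSum (l₁.length + l₂.length) (cutWeight n * φ)
  set V := sqSum (l₁.length + l₂.length) (cutWeight n * ψ)
  have hU : 0 ≤ U := sqSum_nonneg _ _
  have hV : 0 ≤ V := sqSum_nonneg _ _
  simp only [growthBound]
  set Y := sNormE s (ψ : (Fin 2 → ℝ) → ℝ)
  set X := sNormE s (φ : (Fin 2 → ℝ) → ℝ)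
  calc _ ≤ ENNReal.ofReal (C * ((4 * b) ^ 2 * U + (4 * a) ^ 2 * V)) := ENNReal.ofReal_le_ofReal hm
    _ = ENNReal.ofReal C * (16 * (ENNReal.ofReal b ^ 2 * ENNReal.ofReal U
          + ENNReal.ofReal a ^ 2 * ENNReal.ofReal V)) := by
        rw [show C * ((4 * b) ^ 2 * U + (4 * a) ^ 2 * V)
          = C * (16 * (b ^ 2 * U + a ^ 2 * V)) by ring, ENNReal.ofReal_mul hC0,
          ENNReal.ofReal_mul (by norm_num), ENNReal.ofReal_add (by positivity) (by positivity),
          ENNReal.ofReal_mul (by positivity), ENNReal.ofReal_mul (by positivity),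
          ENNReal.ofReal_pow hb.le, ENNReal.ofReal_pow ha.le]
        norm_num
    _ ≤ ENNReal.ofReal C * (16 * (ENNReal.ofReal b ^ 2 * (K * X ^ 2)
          + ENNReal.ofReal a ^ 2 * (K * Y ^ 2))) := by gcongr
    _ = ENNReal.ofReal C * (16 * K) * ((ENNReal.ofReal a * Y) ^ 2 + (X * ENNReal.ofReal b) ^ 2) := by
        ring
    _ ≤ ENNReal.ofReal C * (16 * K) * (ENNReal.ofReal a * Y + X * ENNReal.ofReal b) ^ 2 := by
        gcongr
        rw [add_sq', add_assoc]
        gcongr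
        exact le_self_add
    _ = _ := by
        rw [mul_pow, ← ENNReal.coe_pow, NNReal.sq_sqrt]
        rfl

lemma exists_bound_weightFun_mul_mul {s : ℕ} (l₁ l₂ : List (Fin 3))
    (hl : l₁.length + l₂.length ≤ s) :
    ∃ C : ℝ≥0, ∀ x ∈ growthSet,
      eLpNorm ((wordOp l₁ (weightFun 0 (-2) * x.1) * wordOp l₂ (weightFun 0 (-2) * x.2.1) :
        smoothFun) : (Fin 2 → ℝ) → ℝ) 2 Gmeasure ≤ C * growthBound s x := by
  obtain ⟨C, hC⟩ := exists_bound_cutWeight_mul_mul l₁ l₂ hl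
  refine ⟨C, fun x hx => ?_⟩
  refine Lp.eLpNorm_le_of_ae_tendsto (u := atTop) (Eventually.of_forall fun n => hC n x hx)
    (fun n => (smoothFun.continuous _).aestronglyMeasurable) (ae_of_all _ fun z => ?_)
  refine tendsto_const_nhds.congr' ?_
  filter_upwards [eventually_mem_cutSet z] with n hn
  have h : ∀ F : smoothFun, ∀ w ∈ cutSet n, ((weightFun 0 (-2) * F : smoothFun) :
      (Fin 2 → ℝ) → ℝ) w = ((cutWeight n * F : smoothFun) : (Fin 2 → ℝ) → ℝ) w := by
    intro F w hw
    rw [Subalgebra.coe_mul, Subalgebra.coe_mul, Pi.mul_apply, Pi.mul_apply,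
      cutWeight_eq (le_of_lt hw)]
  simp only [Subalgebra.coe_mul (S := smoothFun), Pi.mul_apply]
  rw [wordOp_congr_of_isOpen l₁ (isOpen_cutSet n) (h x.1) z hn,
    wordOp_congr_of_isOpen l₂ (isOpen_cutSet n) (h x.2.1) z hn]

lemma weightFun_mul_mul (κ : ℝ) (φ ψ : smoothFun) :
    ((weightFun κ 4 * (weightFun 0 (-2) * φ * (weightFun 0 (-2) * ψ)) : smoothFun) :
      (Fin 2 → ℝ) → ℝ) = fun z => Real.exp (-(κ * zjap z))
        * ((φ : (Fin 2 → ℝ) → ℝ) z * (ψ : (Fin 2 → ℝ) → ℝ) z) := by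
  funext z
  have : weightProfile κ 4 (znorm z) * weightProfile 0 (-2) (znorm z)
      * weightProfile 0 (-2) (znorm z) = Real.exp (-(κ * zjap z)) := by
    rw [weightProfile, weightProfile, ← Real.exp_add, ← Real.exp_add, zjap_eq]
    congr 1
    ring
  simp only [Subalgebra.coe_mul, Pi.mul_apply, weightFun_apply]
  rw [← this]
  ring

lemma exists_bound_sNormE_mul {κ : ℝ} (hκ : 4 ≤ κ) (s : ℕ) :
    ∃ C : ℝ≥0, ∀ x ∈ growthSet, sNormE s (fun z => Real.exp (-(κ * zjap z))
        * ((x.1 : (Fin 2 → ℝ) → ℝ) z * (x.2.1 : (Fin 2 → ℝ) → ℝ) z)) ≤ C * growthBound s x := by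
  have h : ∀ I : ℕ × ℕ × ℕ, ∃ C : ℝ≥0, I ∈ multiIndices s → ∀ x ∈ growthSet,
      eLpNorm (GammaI I (fun z => Real.exp (-(κ * zjap z))
        * ((x.1 : (Fin 2 → ℝ) → ℝ) z * (x.2.1 : (Fin 2 → ℝ) → ℝ) z))) 2 Gmeasure
        ≤ C * growthBound s x := by
    intro I
    by_cases hI : I ∈ multiIndices s
    · have hlen : I.1 + I.2.1 + I.2.2 ≤ s := (Finset.mem_filter.1 hI).2
      obtain ⟨C, hC⟩ := exists_bound_wordOp_mul_of_bounded (S := growthSet) (B := growthBound s)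
        (u := fun _ => weightFun κ 4)
        (v := fun x => weightFun 0 (-2) * x.1 * (weightFun 0 (-2) * x.2.1))
        (List.replicate I.1 0 ++ List.replicate I.2.1 1 ++ List.replicate I.2.2 2)
        (fun l => by
          obtain ⟨C, hC0, hC⟩ := exists_bound_wordOp_weightFun hκ l
          exact ⟨C, hC0, fun _ => hC⟩)
        (fun l hl => exists_bound_wordOp_mul l [] [] fun l₁ l₂ h =>
          exists_bound_weightFun_mul_mul l₁ l₂ (by simp at h hl; omega))
      refine ⟨C, fun _ x hx => ?_⟩
      rw [← weightFun_mul_mul, GammaI_eq, orderedOp_eq_wordOp]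
      exact hC x hx
    · exact ⟨0, fun h => absurd h hI⟩
  choose C hC using h
  refine ⟨∑ I ∈ multiIndices s, C I, fun x hx => ?_⟩
  rw [sNormE, ENNReal.ofNNReal_finsetSum, Finset.sum_mul]
  exact Finset.sum_le_sum fun I hI => hC I hI x hx

instance : Gmeasure.IsOpenPosMeasure := by
  rw [Gmeasure_eq]
  refine (withDensity_absolutelyContinuous' (by
    exact continuous_density.measurable.ennreal_ofReal.aemeasurable)
    (ae_of_all _ fun z => ?_)).isOpenPosMeasure
  exact (ENNReal.ofReal_pos.2 (sinhcSq_pos (normSqFun_nonneg z))).ne'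

lemma sNormE_zero (s : ℕ) : sNormE s (fun _ => 0) = 0 := by
  refine Finset.sum_eq_zero fun I _ => ?_
  rw [show (fun _ => 0 : (Fin 2 → ℝ) → ℝ) = ((0 : smoothFun) : (Fin 2 → ℝ) → ℝ) from rfl,
    GammaI_eq, map_zero]
  exact eLpNorm_zero

lemma eq_zero_of_sNormE_eq_zero {s : ℕ} {F : smoothFun}
    (h : sNormE s (F : (Fin 2 → ℝ) → ℝ) = 0) : (F : (Fin 2 → ℝ) → ℝ) = 0 := by
  obtain ⟨C, hC⟩ := eLpNorm_wordOp_le_sNormE s [] (Nat.zero_le s)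
  have h0 := hC F
  rw [h, mul_zero, nonpos_iff_eq_zero, wordOp_nil, Module.End.one_apply,
    eLpNorm_eq_zero_iff (smoothFun.continuous F).aestronglyMeasurable two_ne_zero] at h0
  exact ((smoothFun.continuous F).ae_eq_iff_eq Gmeasure continuous_zero).1 h0

lemma enorm_le_eLpNorm_top {f : (Fin 2 → ℝ) → ℝ} (hf : Continuous f) (z : Fin 2 → ℝ) :
    ‖f z‖ₑ ≤ eLpNorm f ⊤ volume := by
  have hcl : IsClosed {z | ‖f z‖ₑ ≤ eLpNorm f ⊤ volume} :=
    isClosed_le hf.enorm continuous_const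
  have hd : Dense {z | ‖f z‖ₑ ≤ eLpNorm f ⊤ volume} := by
    refine Measure.dense_of_ae (μ := volume) ?_
    rw [eLpNorm_exponent_top]
    exact ae_le_eLpNormEssSup
  have := hd.closure_eq
  rw [hcl.closure_eq] at this
  exact this.ge (Set.mem_univ z)

lemma continuous_exp_znorm_mul (F : smoothFun) :
    Continuous fun z => Real.exp (-(2 * znorm z)) * (F : (Fin 2 → ℝ) → ℝ) z :=
  (Real.continuous_exp.comp (continuous_const.mul continuous_znorm).neg).mul
    (smoothFun.continuous F)

lemma eq_zero_of_eLpNorm_top_eq_zero {F : smoothFun}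
    (h : eLpNorm (fun z => Real.exp (-(2 * znorm z)) * (F : (Fin 2 → ℝ) → ℝ) z) ⊤ volume = 0) :
    (F : (Fin 2 → ℝ) → ℝ) = 0 := by
  funext z
  have hz := enorm_le_eLpNorm_top (continuous_exp_znorm_mul F) z
  rw [h, nonpos_iff_eq_zero, enorm_eq_zero] at hz
  exact (mul_eq_zero.1 hz).resolve_left (Real.exp_pos _).ne'

lemma exp_mul_abs_le_toReal {F : smoothFun}
    (h : eLpNorm (fun z => Real.exp (-(2 * znorm z)) * (F : (Fin 2 → ℝ) → ℝ) z) ⊤ volume ≠ ⊤)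
    (z : Fin 2 → ℝ) : Real.exp (-(2 * znorm z)) * |(F : (Fin 2 → ℝ) → ℝ) z|
      ≤ (eLpNorm (fun z => Real.exp (-(2 * znorm z)) * (F : (Fin 2 → ℝ) → ℝ) z) ⊤ volume).toReal := by
  have hz := ENNReal.toReal_mono h (enorm_le_eLpNorm_top (continuous_exp_znorm_mul F) z)
  rwa [toReal_enorm, Real.norm_eq_abs, abs_mul, Real.abs_exp] at hz

/-- the bilinear estimate
`‖e^{−κ⟨z⟩}φψ‖_{(s)} ≤ C(‖e^{−2|z|}φ‖_{L^∞}‖ψ‖_{(s)} + ‖φ‖_{(s)}‖e^{−2|z|}ψ‖_{L^∞})` for `κ > 9/2`.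
(The inequality is stated in `ℝ≥0∞`, so it is trivially true when the right-hand side is
infinite; this encodes the proviso that the right-hand side be finite.) -/
theorem weighted_bilinear_estimate (κ : ℝ) (hκ : 9/2 < κ) (s : ℕ) :
    ∃ C : ℝ≥0, 0 < C ∧
      ∀ φ ψ : (Fin 2 → ℝ) → ℝ, ContDiff ℝ (⊤ : ℕ∞) φ → ContDiff ℝ (⊤ : ℕ∞) ψ →
        sNormE s (fun z => Real.exp (-(κ * zjap z)) * (φ z * ψ z))
          ≤ C * (eLpNorm (fun z => Real.exp (-(2 * znorm z)) * φ z) ⊤ volume * sNormE s ψ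
              + sNormE s φ * eLpNorm (fun z => Real.exp (-(2 * znorm z)) * ψ z) ⊤ volume) := by
  obtain ⟨C, hC⟩ := exists_bound_sNormE_mul (κ := κ) (by linarith) s
  refine ⟨C + 1, by positivity, fun φ ψ hφ hψ => ?_⟩
  by_cases hφ0 : φ = 0
  · simp only [hφ0, Pi.zero_apply, zero_mul, mul_zero, sNormE_zero]
    exact bot_le
  by_cases hψ0 : ψ = 0
  · simp only [hψ0, Pi.zero_apply, mul_zero, sNormE_zero]
    exact bot_le
  obtain ⟨F, rfl⟩ : ∃ F : smoothFun, (F : (Fin 2 → ℝ) → ℝ) = φ := ⟨⟨φ, hφ⟩, rfl⟩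
  obtain ⟨G, rfl⟩ : ∃ G : smoothFun, (G : (Fin 2 → ℝ) → ℝ) = ψ := ⟨⟨ψ, hψ⟩, rfl⟩
  have hA0 := mt eq_zero_of_eLpNorm_top_eq_zero hφ0
  have hB0 := mt eq_zero_of_eLpNorm_top_eq_zero hψ0
  have hX0 : sNormE s (F : (Fin 2 → ℝ) → ℝ) ≠ 0 := mt eq_zero_of_sNormE_eq_zero hφ0
  have hY0 : sNormE s (G : (Fin 2 → ℝ) → ℝ) ≠ 0 := mt eq_zero_of_sNormE_eq_zero hψ0
  have hC1 : ((C + 1 : ℝ≥0) : ℝ≥0∞) ≠ 0 := by simp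
  by_cases hA : eLpNorm (fun z => Real.exp (-(2 * znorm z)) * (F : (Fin 2 → ℝ) → ℝ) z) ⊤ volume = ⊤
  · rw [hA, ENNReal.top_mul hY0, top_add, ENNReal.mul_top hC1]
    exact le_top
  by_cases hB : eLpNorm (fun z => Real.exp (-(2 * znorm z)) * (G : (Fin 2 → ℝ) → ℝ) z) ⊤ volume = ⊤
  · rw [hB, ENNReal.mul_top hX0, add_top, ENNReal.mul_top hC1]
    exact le_top
  have key := hC (F, G,
    (eLpNorm (fun z => Real.exp (-(2 * znorm z)) * (F : (Fin 2 → ℝ) → ℝ) z) ⊤ volume).toReal,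
    (eLpNorm (fun z => Real.exp (-(2 * znorm z)) * (G : (Fin 2 → ℝ) → ℝ) z) ⊤ volume).toReal)
    ⟨ENNReal.toReal_pos hA0 hA, ENNReal.toReal_pos hB0 hB,
    exp_mul_abs_le_toReal hA, exp_mul_abs_le_toReal hB⟩
  simp only [growthBound, ENNReal.ofReal_toReal hA, ENNReal.ofReal_toReal hB] at key
  refine key.trans ?_
  gcongr
  exact le_self_add
end
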